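/- arXiv:0711.1940 — 3 statements merged into one kernel-verified Lean document; each statement's English description precedes it below -/
import Mathlib

section
/- There exists an absolute constant C > 0 with the following property. Suppose each unit cell [i,i+1) × [j,j+1), i,j ∈ ℤ, of the plane is assigned a color, black or white (i.e., a value z_{ij} ∈ {+1,−1}), and let f : ℝ² → {+1,−1} be the function equal to z_{ij} on the cell [i,i+1) × [j,j+1). Then for every L > 0 there exists a straight line segment I of length |I| ≥ L such that |∫_I f| ≥ C √|I|, where ∫_I f denotes the integral of f along the segment I with respect to one-dimensional (arc-length) measure. -/
open MeasureTheory Real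

/-- The integral of `f` along the straight line segment with endpoints `a` and `b`,
with respect to one-dimensional arc-length measure. -/
noncomputable def segmentIntegral (f : EuclideanSpace ℝ (Fin 2) → ℝ)
    (a b : EuclideanSpace ℝ (Fin 2)) : ℝ :=
  ‖b - a‖ * ∫ t in (0:ℝ)..1, f (a + t • (b - a))

noncomputable def kk (u : ℝ) : ℝ := 1 - 2*u^2 + 2 * |u| * √(u^2-1)

lemma kk_cont : Continuous kk := by unfold kk; fun_prop

lemma kk_neg (u : ℝ) : kk (-u) = kk u := by simp [kk]

lemma kk_bound (u : ℝ) : |kk u| ≤ 2 * (1+u^2)⁻¹ := by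
  have h0 : (0:ℝ) < 1 + u^2 := by positivity
  rw [← div_eq_mul_inv, le_div_iff₀ h0, ← abs_of_pos h0, ← abs_mul, abs_le]
  unfold kk
  rw [← sq_abs u]
  have hu := abs_nonneg u
  set v := |u|
  rcases le_total (v^2) 1 with h | h
  · rw [Real.sqrt_eq_zero_of_nonpos (by linarith)]
    constructor <;> nlinarith [sq_nonneg v, sq_nonneg (v^2)]
  · have hs := Real.sq_sqrt (show 0 ≤ v^2-1 by linarith)
    have hs0 := Real.sqrt_nonneg (v^2-1)
    set w := √(v^2-1)
    have hv : 1 ≤ v := by nlinarith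
    have hvw : w ≤ v := by nlinarith
    have e : 1 - 2*v^2 + 2*v*w = -(v-w)^2 := by nlinarith
    rw [e]
    have e2 : (v-w)*(v+w) = 1 := by nlinarith
    have h3 : (v-w)*v ≤ 1 := by nlinarith
    have h4 : 0 ≤ (v-w)*v := by nlinarith
    have h5 : v - w ≤ 1 := by nlinarith
    have h6 : (v-w)^2*v^2 ≤ 1 := by nlinarith
    have h7 : (v-w)^2 ≤ 1 := by nlinarith
    constructor <;> nlinarith [sq_nonneg (v-w)]

lemma kk_int (r : ℝ) (hr : 0 ≤ r) :
    ∫ θ in (-(π/2))..(π/2), kk (r * cos θ) = π * max (1 - r^2) 0 := by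
  have hc : ∀ θ ∈ Set.uIcc (-(π/2)) (π/2), 0 ≤ cos θ := by
    intro θ h
    rw [Set.uIcc_of_le (by linarith [pi_pos])] at h
    exact cos_nonneg_of_mem_Icc h
  have h1 : ∫ θ in (-(π/2))..(π/2), kk (r * cos θ) =
      ∫ θ in (-(π/2))..(π/2), ((1 - 2*r^2*cos θ^2)
        + 2*r*(√(r^2 - 1 - r^2 * (sin θ)^2) * cos θ)) := by
    apply intervalIntegral.integral_congr
    intro θ h
    have := hc θ h
    simp only [kk]
    rw [abs_of_nonneg (mul_nonneg hr this), show (r * cos θ)^2 - 1 = r^2 - 1 - r^2 * (sin θ)^2 by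
      rw [sin_sq]; ring]
    ring
  have i1 : IntervalIntegrable (fun θ => 1 - 2*r^2*cos θ^2) volume (-(π/2)) (π/2) := by
    apply Continuous.intervalIntegrable; fun_prop
  have i2 : IntervalIntegrable (fun θ => 2*r*(√(r^2 - 1 - r^2 * (sin θ)^2) * cos θ)) volume
      (-(π/2)) (π/2) := by
    apply Continuous.intervalIntegrable; fun_prop
  rw [h1, intervalIntegral.integral_add i1 i2]
  have h2 : ∫ θ in (-(π/2))..(π/2), (1 - 2*r^2*cos θ^2) = π - r^2 * π := by
    rw [intervalIntegral.integral_sub (by simp) (by apply Continuous.intervalIntegrable; fun_prop),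
      intervalIntegral.integral_const_mul, integral_cos_sq]
    simp
    ring
  have h3 : ∫ θ in (-(π/2))..(π/2), (√(r^2 - 1 - r^2 * (sin θ)^2) * cos θ)
     = ∫ w in (-1:ℝ)..1, √(r^2 - 1 - r^2 * w^2) := by
    have := intervalIntegral.integral_comp_mul_deriv (a := -(π/2)) (b := π/2) (f := sin) (f' := cos)
      (g := fun w => √(r^2 - 1 - r^2 * w^2)) (fun x _ => hasDerivAt_sin x) (by fun_prop) (by fun_prop)
    simpa using this
  rw [h2, intervalIntegral.integral_const_mul, h3]
  rcases le_total r 1 with h | h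
  · have : ∫ w in (-1:ℝ)..1, √(r^2 - 1 - r^2 * w^2) = 0 := by
      rw [intervalIntegral.integral_congr (g := fun _ => (0:ℝ))]
      · simp
      · intro w _
        apply Real.sqrt_eq_zero_of_nonpos
        nlinarith [sq_nonneg (r*w)]
    rw [this, max_eq_left (by nlinarith)]; ring
  · rw [max_eq_right (by nlinarith)]
    set q := √(r^2-1) with hq
    have hq2 : q^2 = r^2-1 := Real.sq_sqrt (by nlinarith)
    have hq0 : 0 ≤ q := Real.sqrt_nonneg _
    have hr0 : 0 < r := by linarith
    rcases eq_or_lt_of_le hq0 with hz | hz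
    · have hr1 : r^2 = 1 := by rw [← hz] at hq2; linarith
      have : ∫ w in (-1:ℝ)..1, √(r^2 - 1 - r^2 * w^2) = 0 := by
        rw [intervalIntegral.integral_congr (g := fun _ => (0:ℝ))]
        · simp
        · intro w _
          apply Real.sqrt_eq_zero_of_nonpos
          nlinarith [sq_nonneg (r*w)]
      rw [this, hr1]; ring
    have key : ∫ w in (-1:ℝ)..1, √(r^2 - 1 - r^2 * w^2) = q * (q/r) * (π/2) := by
      have e1 : ∀ w : ℝ, √(r^2 - 1 - r^2 * w^2) = q * √(1 - ((r/q)*w)^2) := by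
        intro w
        rw [← Real.sqrt_sq hq0, ← Real.sqrt_mul (by positivity), Real.sqrt_sq hq0]
        congr 1
        field_simp
        rw [hq2]
      simp_rw [e1]
      rw [intervalIntegral.integral_const_mul,
        intervalIntegral.integral_comp_mul_left (fun x => √(1 - x^2)) (by positivity)]
      have hrq : 1 ≤ r/q := by rw [one_le_div hz]; nlinarith
      have ii : ∀ a b, IntervalIntegrable (fun x:ℝ => √(1-x^2)) volume a b := fun a b => by
        apply Continuous.intervalIntegrable; fun_prop
      have e2 : ∫ x in (r/q * -1)..(r/q*1), √(1-x^2) = π/2 := by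
        rw [← intervalIntegral.integral_add_adjacent_intervals (ii _ (-1)) (ii _ _),
          ← intervalIntegral.integral_add_adjacent_intervals (ii (-1) 1) (ii _ _),
          integral_sqrt_one_sub_sq]
        rw [intervalIntegral.integral_congr (g := fun _ => (0:ℝ)) (a := r/q * -1),
          intervalIntegral.integral_congr (g := fun _ => (0:ℝ)) (a := 1)]
        · simp
        · intro x hx
          rw [Set.uIcc_of_le (by linarith)] at hx
          apply Real.sqrt_eq_zero_of_nonpos
          nlinarith [hx.1]
        · intro x hx
          rw [Set.uIcc_of_le (by linarith)] at hx
          apply Real.sqrt_eq_zero_of_nonpos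
          nlinarith [hx.2]
      rw [e2]
      simp
      ring
    rw [key]
    field_simp
    rw [hq2]; ring

noncomputable def lin (θ : ℝ) (z : ℂ) : ℝ := z.re * cos θ + z.im * sin θ

noncomputable def GG (z : ℂ) : ℝ := π * max (1 - 100*‖z‖^2) 0

lemma kk_rot (z : ℂ) : ∫ θ in (0:ℝ)..π, kk (10 * lin θ z) = GG z := by
  have h : ∀ θ, kk (10 * lin θ z) = kk ((10*‖z‖) * cos (θ - z.arg)) := by
    intro θ
    congr 1
    rw [cos_sub, lin]
    have h1 := Complex.norm_mul_cos_arg z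
    have h2 := Complex.norm_mul_sin_arg z
    linear_combination (-10 * cos θ) * h1 + (-10 * sin θ) * h2
  simp_rw [h]
  have hp : Function.Periodic (fun x => kk ((10*‖z‖) * cos x)) π := by
    intro x
    simp only [cos_add_pi, mul_neg, kk_neg]
  rw [intervalIntegral.integral_comp_sub_right (fun x => kk ((10*‖z‖) * cos x))]
  have := hp.intervalIntegral_add_eq (0 - z.arg) (-(π/2))
  rw [show 0 - z.arg + π = π - z.arg by ring, show -(π/2)+π = π/2 by ring] at this
  rw [this, kk_int _ (by positivity), GG]
  ring_nf

noncomputable def PP (θ s t : ℝ) : ℂ := ⟨s * cos θ - t * sin θ, s * sin θ + t * cos θ⟩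

lemma lin_PP (θ s t : ℝ) : lin θ (PP θ s t) = s := by
  simp only [lin, PP]
  linear_combination s * sin_sq_add_cos_sq θ

lemma lin_sub (θ : ℝ) (z w : ℂ) : lin θ (z - w) = lin θ z - lin θ w := by
  simp [lin]; ring

lemma norm_PP (θ s t : ℝ) : ‖PP θ s t‖^2 = s^2 + t^2 := by
  rw [← Complex.normSq_eq_norm_sq, Complex.normSq_apply]
  simp only [PP]
  linear_combination (s^2+t^2) * sin_sq_add_cos_sq θ

lemma cont_PP (θ : ℝ) : Continuous (fun p : ℝ × ℝ => PP θ p.1 p.2) := by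
  have : (fun p : ℝ × ℝ => PP θ p.1 p.2) = fun p : ℝ × ℝ =>
      ((p.1 * cos θ - p.2 * sin θ : ℝ) : ℂ) + ((p.1 * sin θ + p.2 * cos θ : ℝ) : ℂ) * Complex.I := by
    funext p
    apply Complex.ext <;> simp [PP, Complex.cos_ofReal_re, Complex.sin_ofReal_re]
  rw [this]; fun_prop

lemma cont_lin : Continuous (fun p : ℝ × ℂ => lin p.1 p.2) := by
  unfold lin; fun_prop

lemma mp_PP (θ : ℝ) : MeasurePreserving (fun p : ℝ × ℝ => PP θ p.1 p.2) volume volume := by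
  have h1 := (Complex.volume_preserving_equiv_real_prod).symm
  have h2 := (rotation (Circle.exp θ)).measurePreserving
  have h3 := h2.comp h1
  suffices hh : (fun p : ℝ × ℝ => PP θ p.1 p.2) =
      ((rotation (Circle.exp θ)) ∘ Complex.measurableEquivRealProd.symm) by
    rw [hh]; exact h3
  funext p
  simp only [Function.comp, rotation_apply, Circle.coe_exp, Complex.exp_mul_I]
  apply Complex.ext
  · simp [PP, Complex.measurableEquivRealProd, Complex.cos_ofReal_re, Complex.sin_ofReal_re]; try ring
  · simp [PP, Complex.measurableEquivRealProd, Complex.cos_ofReal_re, Complex.sin_ofReal_re]; try ring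

lemma integral_PP (θ : ℝ) (u : ℂ → ℝ) (hm : Measurable u) (hu : Integrable u) :
    ∫ z, u z = ∫ s, ∫ t, u (PP θ s t) := by
  have h := mp_PP θ
  rw [← h.map_eq, integral_map h.measurable.aemeasurable (hm.aestronglyMeasurable)]
  have : Integrable (fun p : ℝ × ℝ => u (PP θ p.1 p.2)) := h.integrable_comp_of_integrable hu
  exact integral_prod _ this

lemma kk_meas : Measurable kk := kk_cont.measurable

lemma kk_le_two (u : ℝ) : |kk u| ≤ 2 := by
  refine (kk_bound u).trans ?_
  have : (1+u^2)⁻¹ ≤ 1 := inv_le_one_of_one_le₀ (by nlinarith [sq_nonneg u])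
  linarith

lemma kk_shift_int (s : ℝ) : Integrable (fun x => |kk (10 * (s - x))|) := by
  have h1 : Integrable (fun x:ℝ => 2 * (1 + (10 * x)^2)⁻¹) :=
    (integrable_inv_one_add_sq.comp_mul_left' (by norm_num : (10:ℝ) ≠ 0)).const_mul 2
  have h2 := h1.comp_sub_left s
  refine h2.mono (by have := kk_cont; fun_prop) ?_
  filter_upwards with x
  rw [Real.norm_eq_abs, abs_abs]
  exact (kk_bound _).trans (le_abs_self _)

lemma kk_shift (s : ℝ) : ∫ x, |kk (10 * (s - x))| ≤ 2 * π / 10 := by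
  have h1 : Integrable (fun x:ℝ => 2 * (1 + (10 * x)^2)⁻¹) :=
    (integrable_inv_one_add_sq.comp_mul_left' (by norm_num : (10:ℝ) ≠ 0)).const_mul 2
  have h2 := h1.comp_sub_left s
  refine (integral_mono (kk_shift_int s) h2 (fun x => kk_bound _)).trans ?_
  rw [integral_sub_left_eq_self (fun x:ℝ => 2 * (1 + (10 * x)^2)⁻¹), integral_const_mul,
    Measure.integral_comp_mul_left (fun x:ℝ => (1 + x^2)⁻¹), integral_univ_inv_one_add_sq]
  simp [abs_of_pos]
  apply le_of_eq; ring

lemma Phi_bound (θ B N : ℝ) (hN : 0 ≤ N) (F : ℂ → ℝ) (hm : Measurable F) (hF : Integrable F)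
    (hsupp : ∀ z, 2 * N < ‖z‖ → F z = 0) (hB : ∀ s, |∫ t, F (PP θ s t)| ≤ B) :
    ∫ z, F z * ∫ w, F w * kk (10 * lin θ (z - w)) ≤ 4 * N * (B * (B * (2 * π / 10))) := by
  set R : ℝ → ℝ := fun s => ∫ t, F (PP θ s t) with hR
  have hB0 : 0 ≤ B := (abs_nonneg _).trans (hB 0)
  have hRm : StronglyMeasurable R :=
    StronglyMeasurable.integral_prod_right (f := fun s t => F (PP θ s t))
      ((hm.comp (cont_PP θ).measurable).stronglyMeasurable)
  have hR0 : ∀ s, 2 * N < |s| → R s = 0 := by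
    intro s hs
    have : ∀ t, F (PP θ s t) = 0 := by
      intro t
      apply hsupp
      have := norm_PP θ s t
      exact hs.trans_le (abs_le_of_sq_le_sq (by nlinarith) (norm_nonneg _))
    simp [hR, this]
  have hlin : Measurable (lin θ) := by
    have := cont_lin.comp (Continuous.prodMk_right θ)
    exact this.measurable
  have hA : ∀ (H : ℝ → ℝ) (c : ℝ), Measurable H → (∀ x, |H x| ≤ c) →
      ∫ z, F z * H (lin θ z) = ∫ s, R s * H s := by
    intro H c hH hc
    rw [integral_PP θ (fun z => F z * H (lin θ z)) (hm.mul (hH.comp hlin))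
      (hF.mul_bdd (c := c) (hH.comp hlin).aestronglyMeasurable (by filter_upwards with x using hc _))]
    congr 1; funext s
    simp_rw [lin_PP]
    rw [integral_mul_const]
  set H : ℝ → ℝ := fun s => ∫ x, R x * kk (10 * (s - x)) with hH
  have h1 : ∀ z, ∫ w, F w * kk (10 * lin θ (z - w)) = H (lin θ z) := by
    intro z
    simp_rw [lin_sub]
    exact hA (fun x => kk (10 * (lin θ z - x))) 2 (by have := kk_meas; fun_prop) (fun x => kk_le_two _)
  simp_rw [h1]
  have hHm : Measurable H := by
    refine (StronglyMeasurable.integral_prod_right (f := fun s x => R x * kk (10 * (s - x))) ?_).measurable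
    have := hRm.measurable
    have := kk_meas
    refine Measurable.stronglyMeasurable ?_
    unfold Function.uncurry
    fun_prop
  have hHb : ∀ s, |H s| ≤ B * (2 * π / 10) := by
    intro s
    rw [← Real.norm_eq_abs, hH]
    refine (norm_integral_le_of_norm_le ((kk_shift_int s).const_mul B) ?_).trans ?_
    · filter_upwards with x
      rw [norm_mul]
      exact mul_le_mul_of_nonneg_right (hB x) (norm_nonneg _)
    · rw [integral_const_mul]
      exact mul_le_mul_of_nonneg_left (kk_shift s) hB0
  rw [hA H _ hHm hHb]
  have h2 : ∫ s, R s * H s = ∫ s in Set.Icc (-(2*N)) (2*N), R s * H s := by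
    symm
    apply setIntegral_eq_integral_of_forall_compl_eq_zero
    intro x hx
    rw [hR0 x, zero_mul]
    by_contra hcon
    exact hx (abs_le.1 (not_lt.1 hcon))
  rw [h2]
  have h3 := norm_setIntegral_le_of_norm_le_const (μ := volume) (s := Set.Icc (-(2*N)) (2*N))
    (f := fun s => R s * H s) (C := B * (B * (2 * π / 10))) (by simp) (by
      intro x _
      rw [norm_mul]
      exact mul_le_mul (hB x) (hHb x) (norm_nonneg _) hB0)
  refine (le_abs_self _).trans (h3.trans ?_)
  rw [Real.volume_real_Icc_of_le (by linarith)]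
  apply le_of_eq; ring

lemma GG_cont : Continuous GG := by unfold GG; fun_prop

lemma GG_bound (z : ℂ) : |GG z| ≤ π := by
  unfold GG
  have : max (1 - 100 * ‖z‖^2) 0 ≤ 1 := max_le (by nlinarith [norm_nonneg z]) (by norm_num)
  rw [abs_of_nonneg (mul_nonneg pi_pos.le (le_max_right _ _))]
  nlinarith [pi_pos]

lemma swap_id (F : ℂ → ℝ) (hF : Integrable F) :
    ∫ z, F z * ∫ w, F w * GG (z - w) =
    ∫ θ in (0:ℝ)..π, ∫ z, F z * ∫ w, F w * kk (10 * lin θ (z - w)) := by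
  have hFF : Integrable (fun p : ℂ × ℂ => F p.1 * F p.2) := hF.mul_prod hF
  have hl := cont_lin
  have hk := kk_cont
  have e1 : ∀ θ, ∫ z, F z * ∫ w, F w * kk (10 * lin θ (z - w)) =
      ∫ p : ℂ × ℂ, F p.1 * F p.2 * kk (10 * lin θ (p.1 - p.2)) := by
    intro θ
    rw [Measure.volume_eq_prod, integral_prod]
    · simp_rw [← integral_const_mul, mul_assoc]
    · refine hFF.mul_bdd (c := 2) ?_ (by filter_upwards with x using kk_le_two _)
      apply Continuous.aestronglyMeasurable
      unfold lin; fun_prop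
  have e2 : ∫ z, F z * ∫ w, F w * GG (z - w) =
      ∫ p : ℂ × ℂ, F p.1 * F p.2 * GG (p.1 - p.2) := by
    rw [Measure.volume_eq_prod, integral_prod]
    · simp_rw [← integral_const_mul, mul_assoc]
    · refine hFF.mul_bdd (c := π) ?_ (by filter_upwards with x using GG_bound _)
      have := GG_cont
      apply Continuous.aestronglyMeasurable
      fun_prop
  simp_rw [e1, e2, ← kk_rot, ← intervalIntegral.integral_const_mul,
    intervalIntegral.integral_of_le pi_pos.le]
  rw [integral_integral_swap]
  have h1 : Integrable (fun _ : ℝ => (1:ℝ)) (volume.restrict (Set.Ioc 0 π)) := integrable_const _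
  have h2 := hFF.mul_prod h1
  have h3 : Integrable (fun q : (ℂ × ℂ) × ℝ => (F q.1.1 * F q.1.2 * 1) * kk (10 * lin q.2 (q.1.1 - q.1.2)))
      (volume.prod (volume.restrict (Set.Ioc 0 π))) := by
    refine h2.mul_bdd (c := 2) ?_ (by filter_upwards with x using kk_le_two _)
    apply Continuous.aestronglyMeasurable
    unfold lin; fun_prop
  simp only [mul_one] at h3
  exact h3

def QQ (N : ℕ) : Set ℂ := (Set.Ico (0:ℝ) N) ×ℂ (Set.Ico (0:ℝ) N)

def TT (N : ℕ) : Set ℝ := ⋃ i ∈ Finset.range N, Set.Ico ((i:ℝ) + 1/10) ((i:ℝ) + 9/10)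

def SS (N : ℕ) : Set ℂ := (TT N) ×ℂ (TT N)

lemma vol_reProdIm (s t : Set ℝ) (hs : MeasurableSet s) (ht : MeasurableSet t) :
    volume.real (s ×ℂ t) = volume.real s * volume.real t := by
  have h := Complex.volume_preserving_equiv_real_prod
  have e : (s ×ℂ t) = Complex.measurableEquivRealProd ⁻¹' (s ×ˢ t) := by
    ext z; simp [Complex.mem_reProdIm, Complex.measurableEquivRealProd]
  rw [e, measureReal_def, h.measure_preimage (hs.prod ht).nullMeasurableSet,
    Measure.volume_eq_prod, Measure.prod_prod, ENNReal.toReal_mul]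
  rfl

lemma meas_reProdIm (s t : Set ℝ) (hs : MeasurableSet s) (ht : MeasurableSet t) :
    MeasurableSet (s ×ℂ t) := by
  exact (hs.preimage Complex.measurable_re).inter (ht.preimage Complex.measurable_im)

lemma meas_TT (N : ℕ) : MeasurableSet (TT N) := by
  unfold TT
  exact Finset.measurableSet_biUnion _ (fun i _ => measurableSet_Ico)

lemma meas_QQ (N : ℕ) : MeasurableSet (QQ N) := meas_reProdIm _ _ measurableSet_Ico measurableSet_Ico
lemma meas_SS (N : ℕ) : MeasurableSet (SS N) := meas_reProdIm _ _ (meas_TT N) (meas_TT N)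

lemma vol_QQ (N : ℕ) : volume.real (QQ N) = (N:ℝ)^2 := by
  rw [QQ, vol_reProdIm _ _ measurableSet_Ico measurableSet_Ico, Real.volume_real_Ico_of_le (by positivity)]
  ring

lemma vol_TT (N : ℕ) : volume.real (TT N) = 8/10 * (N:ℝ) := by
  have : volume (TT N) = ∑ i ∈ Finset.range N, volume (Set.Ico ((i:ℝ) + 1/10) ((i:ℝ) + 9/10)) := by
    apply measure_biUnion_finset
    · intro i _ j _ hij
      rw [Function.onFun, Set.disjoint_left]
      intro x hx hy
      apply hij
      have h1 : (i:ℝ) < j + 1 := by linarith [hx.1, hy.2]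
      have h2 : (j:ℝ) < i + 1 := by linarith [hx.2, hy.1]
      norm_cast at h1 h2
      omega
    · intro i _; exact measurableSet_Ico
  rw [measureReal_def, this]
  simp only [Real.volume_Ico]
  rw [ENNReal.toReal_sum (by simp)]
  have e : ∀ i : ℕ, (ENNReal.ofReal ((i:ℝ) + 9/10 - (i + 1/10))).toReal = 8/10 := by
    intro i
    rw [ENNReal.toReal_ofReal (by linarith)]; ring
  simp only [e]
  simp; ring

lemma TT_near (N : ℕ) (x y : ℝ) (hx : x ∈ TT N) (hxy : |x - y| < 1/10) :
    ⌊x⌋ = ⌊y⌋ ∧ y ∈ Set.Ico (0:ℝ) N := by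
  simp only [TT, Set.mem_iUnion, Finset.mem_range] at hx
  obtain ⟨i, hi, h1, h2⟩ := hx
  rw [abs_lt] at hxy
  have e1 : ⌊x⌋ = (i:ℤ) := by
    rw [Int.floor_eq_iff]; push_cast; constructor <;> linarith
  have e2 : ⌊y⌋ = (i:ℤ) := by
    rw [Int.floor_eq_iff]; push_cast; constructor <;> linarith
  have hi' : (i:ℝ) + 1 ≤ N := by exact_mod_cast hi
  refine ⟨e1.trans e2.symm, ?_, ?_⟩
  · have : (0:ℝ) ≤ i := by positivity
    linarith
  · linarith

lemma SS_sub (N : ℕ) : SS N ⊆ QQ N := by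
  intro z hz
  exact ⟨(TT_near N _ z.re hz.1 (by simp)).2, (TT_near N _ z.im hz.2 (by simp)).2⟩

lemma vol_SS (N : ℕ) : volume.real (SS N) = 64/100 * (N:ℝ)^2 := by
  rw [SS, vol_reProdIm _ _ (meas_TT N) (meas_TT N), vol_TT]; ring

lemma QQ_norm (N : ℕ) (z : ℂ) (hz : z ∈ QQ N) : ‖z‖ ≤ 2 * N := by
  have h := Complex.norm_le_abs_re_add_abs_im z
  have h1 : |z.re| ≤ N := by rw [abs_of_nonneg hz.1.1]; exact hz.1.2.le
  have h2 : |z.im| ≤ N := by rw [abs_of_nonneg hz.2.1]; exact hz.2.2.le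
  linarith

lemma QQ_fin (N : ℕ) : volume (QQ N) ≠ ⊤ := by
  have : QQ N ⊆ Metric.closedBall 0 (2*N) := by
    intro z hz
    simpa using QQ_norm N z hz
  exact ((measure_mono this).trans_lt measure_closedBall_lt_top).ne

lemma GG_nonneg (z : ℂ) : 0 ≤ GG z := mul_nonneg pi_pos.le (le_max_right _ _)

lemma GG_zero (z : ℂ) (h : 1/10 ≤ ‖z‖) : GG z = 0 := by
  rw [GG, max_eq_right (by nlinarith), mul_zero]

lemma GG_supp : HasCompactSupport GG := by
  apply HasCompactSupport.intro (isCompact_closedBall (0:ℂ) (1/10))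
  intro x hx
  apply GG_zero
  simp at hx
  norm_num
  linarith

lemma GG_int : Integrable GG := GG_cont.integrable_of_hasCompactSupport GG_supp

lemma GG_pos : 0 < ∫ z, GG z :=
  GG_cont.integral_pos_of_hasCompactSupport_nonneg_nonzero GG_supp GG_nonneg (x := 0)
    (by simp [GG, pi_ne_zero])

lemma lower (N : ℕ) (g : ℂ → ℝ) (hm : Measurable g) (hg : ∀ z, g z = 1 ∨ g z = -1)
    (hcell : ∀ z w : ℂ, ⌊z.re⌋ = ⌊w.re⌋ → ⌊z.im⌋ = ⌊w.im⌋ → g z = g w)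
    (hF : Integrable ((QQ N).indicator g)) :
    (∫ z, GG z) * (28/100 * (N:ℝ)^2) ≤
      ∫ z, (QQ N).indicator g z * ∫ w, (QQ N).indicator g w * GG (z - w) := by
  set F := (QQ N).indicator g with hFdef
  set M := ∫ z, GG z with hM
  have hg1 : ∀ z, |g z| = 1 := by intro z; rcases hg z with h | h <;> simp [h]
  have hg2 : ∀ z, g z * g z = 1 := by intro z; rcases hg z with h | h <;> simp [h]
  have hF1 : ∀ z, |F z| ≤ 1 := by
    intro z
    by_cases hz : z ∈ QQ N
    · simp [hFdef, hz, hg1]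
    · simp [hFdef, hz]
  have hGi : ∀ z, Integrable (fun w => GG (z - w)) := fun z => GG_int.comp_sub_left z
  have hGM : ∀ z, ∫ w, GG (z - w) = M := fun z => integral_sub_left_eq_self GG volume z
  have hin : ∀ z, |∫ w, F w * GG (z - w)| ≤ M := by
    intro z
    rw [← Real.norm_eq_abs, ← hGM z]
    refine norm_integral_le_of_norm_le (hGi z) ?_
    filter_upwards with w
    rw [norm_mul, Real.norm_eq_abs, Real.norm_eq_abs, abs_of_nonneg (GG_nonneg _)]
    nlinarith [hF1 w, GG_nonneg (z - w)]
  have hgood : ∀ z ∈ SS N, F z * ∫ w, F w * GG (z - w) = M := by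
    intro z hz
    have hzQ := SS_sub N hz
    rw [← integral_const_mul, ← hGM z]
    congr 1; funext w
    by_cases h : 1/10 ≤ ‖z - w‖
    · rw [GG_zero _ h]; ring
    · push Not at h
      have h1 := TT_near N z.re w.re hz.1 ((by simpa using Complex.abs_re_le_norm (z - w) : |z.re - w.re| ≤ ‖z - w‖).trans_lt h)
      have h2 := TT_near N z.im w.im hz.2 ((by simpa using Complex.abs_im_le_norm (z - w) : |z.im - w.im| ≤ ‖z - w‖).trans_lt h)
      have hwQ : w ∈ QQ N := ⟨h1.2, h2.2⟩
      have := hcell z w h1.1 h2.1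
      simp only [hFdef, Set.indicator_of_mem hzQ, Set.indicator_of_mem hwQ]
      rw [← this, ← mul_assoc, hg2, one_mul]
  have hiS : Integrable ((SS N).indicator (fun _ => 2 * M)) :=
    (integrable_indicator_iff (meas_SS N)).2
      (integrableOn_const (ne_top_of_le_ne_top (QQ_fin N) (measure_mono (SS_sub N))))
  have hiQ : Integrable ((QQ N).indicator (fun _ => M)) :=
    (integrable_indicator_iff (meas_QQ N)).2 (integrableOn_const (QQ_fin N))
  have hmain : ∫ z, ((SS N).indicator (fun _ => 2 * M) z - (QQ N).indicator (fun _ => M) z) ≤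
      ∫ z, F z * ∫ w, F w * GG (z - w) := by
    apply integral_mono (hiS.sub hiQ)
    · refine hF.mul_bdd (c := M) ?_ (by filter_upwards with z using hin z)
      refine (StronglyMeasurable.integral_prod_right (f := fun z w => F w * GG (z - w)) ?_).aestronglyMeasurable
      refine Measurable.stronglyMeasurable ?_
      have h1 : Measurable F := hm.indicator (meas_QQ N)
      have h2 := GG_cont.measurable
      unfold Function.uncurry
      fun_prop
    · intro z
      by_cases hz : z ∈ SS N
      · have := hgood z hz
        simp only [Pi.sub_apply, Set.indicator_of_mem hz, Set.indicator_of_mem (SS_sub N hz)]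
        linarith
      · by_cases hq : z ∈ QQ N
        · simp only [Pi.sub_apply, Set.indicator_of_notMem hz, Set.indicator_of_mem hq]
          have h1 : |F z * ∫ w, F w * GG (z - w)| ≤ 1 * M := by
            rw [abs_mul]
            exact mul_le_mul (hF1 z) (hin z) (abs_nonneg _) (by norm_num)
          linarith [(abs_le.1 h1).1]
        · simp [hFdef, hq, hz]
  refine le_trans (le_of_eq ?_) hmain
  rw [integral_sub hiS hiQ, integral_indicator_const _ (meas_SS N), integral_indicator_const _ (meas_QQ N),
    vol_SS, vol_QQ, smul_eq_mul, smul_eq_mul]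
  ring

lemma chord (f : EuclideanSpace ℝ (Fin 2) → ℝ) (θ s a b : ℝ) (hab : a ≤ b) :
    ∃ p q : EuclideanSpace ℝ (Fin 2), ‖q - p‖ = b - a ∧
      segmentIntegral f p q = ∫ t in a..b, f !₂[(PP θ s t).re, (PP θ s t).im] := by
  refine ⟨!₂[(PP θ s a).re, (PP θ s a).im], !₂[(PP θ s b).re, (PP θ s b).im], ?_⟩
  have hn : ‖(!₂[(PP θ s b).re, (PP θ s b).im] - !₂[(PP θ s a).re, (PP θ s a).im] :
      EuclideanSpace ℝ (Fin 2))‖ = b - a := by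
    rw [EuclideanSpace.norm_eq, ← Real.sqrt_sq (sub_nonneg.2 hab)]
    congr 1
    simp [Fin.sum_univ_two, PP]
    linear_combination (b-a)^2 * sin_sq_add_cos_sq θ
  refine ⟨hn, ?_⟩
  rw [segmentIntegral, hn]
  have := intervalIntegral.smul_integral_comp_add_mul (a := 0) (b := 1)
    (fun t => f !₂[(PP θ s t).re, (PP θ s t).im]) (b - a) a
  rw [smul_eq_mul, mul_zero, add_zero, mul_one, add_sub_cancel] at this
  rw [← this]
  congr 2
  funext t
  congr 1
  ext i
  fin_cases i <;> simp [PP] <;> ring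

lemma R_bound (f : EuclideanSpace ℝ (Fin 2) → ℝ) (hf : ∀ x, f x = 1 ∨ f x = -1) (N : ℕ)
    (C L : ℝ) (hC : 0 < C)
    (hLN : L ≤ C * √(4 * N))
    (H : ∀ p q : EuclideanSpace ℝ (Fin 2), L ≤ ‖q - p‖ →
      |segmentIntegral f p q| < C * √‖q - p‖) (θ s : ℝ) :
    |∫ t, (QQ N).indicator (fun z => f !₂[z.re, z.im]) (PP θ s t)| ≤ C * √(4 * N) := by
  set T : Set ℝ := {t | PP θ s t ∈ QQ N} with hT
  have hPc : Continuous (fun t => PP θ s t) := (cont_PP θ).comp (Continuous.prodMk_right s)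
  have hTm : MeasurableSet T := (meas_QQ N).preimage hPc.measurable
  have e1 : ∫ t, (QQ N).indicator (fun z => f !₂[z.re, z.im]) (PP θ s t) =
      ∫ t in T, f !₂[(PP θ s t).re, (PP θ s t).im] := by
    rw [← integral_indicator hTm]
    congr 1
  rw [e1]
  rcases Set.eq_empty_or_nonempty T with h0 | hne
  · rw [h0]; simp; positivity
  have hTb : ∀ t ∈ T, |t| ≤ 2 * N := by
    intro t ht
    have h1 := QQ_norm N _ ht
    have h2 := norm_PP θ s t
    exact (abs_le_of_sq_le_sq (by nlinarith) (norm_nonneg _)).trans h1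
  have hbb : BddBelow T := ⟨-(2*N), fun t ht => (abs_le.1 (hTb t ht)).1⟩
  have hba : BddAbove T := ⟨2*N, fun t ht => (abs_le.1 (hTb t ht)).2⟩
  have hconv : Convex ℝ T := by
    rw [convex_iff_forall_pos]
    intro x hx y hy a b ha hb hab
    have e : b = 1 - a := by linarith
    have h1 : (PP θ s (a • x + b • y)).re = a * (PP θ s x).re + b * (PP θ s y).re := by
      simp only [PP, e, smul_eq_mul]; ring
    have h2 : (PP θ s (a • x + b • y)).im = a * (PP θ s x).im + b * (PP θ s y).im := by
      simp only [PP, e, smul_eq_mul]; ring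
    have hI := (convex_iff_forall_pos.1 (convex_Ico (𝕜 := ℝ) (0:ℝ) N))
    refine ⟨?_, ?_⟩
    · rw [Set.mem_preimage, h1]; exact hI hx.1 hy.1 ha hb hab
    · rw [Set.mem_preimage, h2]; exact hI hx.2 hy.2 ha hb hab
  have hconn : IsConnected T := ⟨hne, hconv.isPreconnected⟩
  set a := sInf T
  set b := sSup T
  have hs1 : Set.Ioo a b ⊆ T := hconn.Ioo_csInf_csSup_subset hbb hba
  have hs2 : T ⊆ Set.Icc a b := subset_Icc_csInf_csSup hbb hba
  have hab : a ≤ b := by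
    obtain ⟨t, ht⟩ := hne
    exact (hs2 ht).1.trans (hs2 ht).2
  have hab4 : b - a ≤ 4 * N := by
    have h1 : b ≤ 2 * N := csSup_le hne (fun t ht => (abs_le.1 (hTb t ht)).2)
    have h2 : -(2 * N) ≤ a := le_csInf hne (fun t ht => (abs_le.1 (hTb t ht)).1)
    linarith
  have hae : T =ᵐ[volume] Set.Ioc a b := by
    have h1 : Set.Ioo a b =ᵐ[volume] Set.Icc a b := Ioo_ae_eq_Icc
    have h2 : Set.Ioo a b =ᵐ[volume] Set.Ioc a b := Ioo_ae_eq_Ioc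
    refine Filter.EventuallyLE.antisymm ?_ ?_
    · exact (Filter.EventuallyLE.trans_eq (HasSubset.Subset.eventuallyLE hs2) (h1.symm.trans h2))
    · exact (Filter.EventuallyEq.trans_le h2.symm (HasSubset.Subset.eventuallyLE hs1))
  rw [setIntegral_congr_set hae, ← intervalIntegral.integral_of_le hab]
  obtain ⟨p, q, hpq, hseg⟩ := chord f θ s a b hab
  rcases le_total L (b - a) with h | h
  · rw [← hseg]
    refine (H p q (by rw [hpq]; exact h)).le.trans ?_
    rw [hpq]
    exact mul_le_mul_of_nonneg_left (Real.sqrt_le_sqrt hab4) hC.le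
  · have := intervalIntegral.norm_integral_le_of_norm_le_const (a := a) (b := b) (C := 1)
      (f := fun t => f !₂[(PP θ s t).re, (PP θ s t).im]) (by
        intro t _
        rcases hf !₂[(PP θ s t).re, (PP θ s t).im] with h | h <;> simp [h])
    rw [Real.norm_eq_abs, one_mul, abs_of_nonneg (sub_nonneg.2 hab)] at this
    linarith

/-- **The discrepancy of a needle on a checkerboard.**
For any coloring of the unit cells of the plane by `±1`, there are arbitrarily long
line segments `I` with `|∫_I f| ≥ C √|I|`. -/
theorem infinite_checkerboard_discrepancy :
    ∃ C : ℝ, 0 < C ∧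
      ∀ f : EuclideanSpace ℝ (Fin 2) → ℝ,
        (∀ x, f x = 1 ∨ f x = -1) →
        (∀ x y : EuclideanSpace ℝ (Fin 2), ⌊x 0⌋ = ⌊y 0⌋ → ⌊x 1⌋ = ⌊y 1⌋ → f x = f y) →
        ∀ L : ℝ, 0 < L →
          ∃ a b : EuclideanSpace ℝ (Fin 2), L ≤ ‖b - a‖ ∧
            C * Real.sqrt ‖b - a‖ ≤ |segmentIntegral f a b| := by
  set M := ∫ z, GG z with hM
  have hM0 : 0 < M := GG_pos
  refine ⟨√M / 20, by positivity, ?_⟩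
  intro f hf hcell L hL
  by_contra hcon
  push Not at hcon
  set C := √M / 20 with hC
  have hC0 : 0 < C := by positivity
  have hC2 : C^2 = M / 400 := by
    rw [hC, div_pow, Real.sq_sqrt hM0.le]; norm_num
  obtain ⟨N, hN⟩ := exists_nat_ge (max 1 ((L / C)^2))
  have hN1 : (1:ℝ) ≤ N := (le_max_left _ _).trans hN
  have hLN : L ≤ C * √(4 * N) := by
    have h1 : (L / C)^2 ≤ 4 * N := by
      have := (le_max_right _ _).trans hN
      linarith
    have h2 := Real.le_sqrt_of_sq_le h1
    rw [div_le_iff₀ hC0] at h2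
    linarith
  set g : ℂ → ℝ := fun z => f !₂[z.re, z.im] with hg
  have hgm : Measurable g := by
    have : g = (fun p : ℤ × ℤ => f !₂[(p.1:ℝ), (p.2:ℝ)]) ∘ (fun z : ℂ => (⌊z.re⌋, ⌊z.im⌋)) := by
      funext z
      apply hcell <;> simp
    rw [this]
    exact (measurable_of_countable _).comp
      ((Int.measurable_floor.comp Complex.measurable_re).prodMk
        (Int.measurable_floor.comp Complex.measurable_im))
  have hFm : Measurable ((QQ N).indicator g) := hgm.indicator (meas_QQ N)
  have hFi : Integrable ((QQ N).indicator g) := by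
    rw [integrable_indicator_iff (meas_QQ N)]
    refine IntegrableOn.of_bound (QQ_fin N).lt_top hgm.aestronglyMeasurable 1 ?_
    filter_upwards with z
    rcases hf !₂[z.re, z.im] with h | h <;> simp [hg, h]
  have hlow := lower N g hgm (fun z => hf _) (fun z w h1 h2 => hcell _ _ (by simpa using h1) (by simpa using h2)) hFi
  rw [swap_id _ hFi] at hlow
  have hPhi : ∀ θ, ∫ z, (QQ N).indicator g z * ∫ w, (QQ N).indicator g w * kk (10 * lin θ (z - w)) ≤
      4 * N * ((C * √(4 * N)) * ((C * √(4 * N)) * (2 * π / 10))) := by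
    intro θ
    apply Phi_bound θ _ N (by positivity) _ hFm hFi
    · intro z hz
      apply Set.indicator_of_notMem
      intro hq
      linarith [QQ_norm N z hq]
    · intro s
      exact R_bound f hf N C L hC0 hLN hcon θ s
  have hup : ∫ θ in (0:ℝ)..π, ∫ z, (QQ N).indicator g z *
      ∫ w, (QQ N).indicator g w * kk (10 * lin θ (z - w)) ≤
      (4 * N * ((C * √(4 * N)) * ((C * √(4 * N)) * (2 * π / 10)))) * π := by
    by_cases hi : IntervalIntegrable (fun θ => ∫ z, (QQ N).indicator g z *
      ∫ w, (QQ N).indicator g w * kk (10 * lin θ (z - w))) volume 0 π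
    · refine (intervalIntegral.integral_mono pi_pos.le hi (by simp) (fun θ => hPhi θ)).trans ?_
      simp
      apply le_of_eq; ring
    · rw [intervalIntegral.integral_undef hi]
      positivity
  have hs : √(4 * (N:ℝ))^2 = 4 * N := Real.sq_sqrt (by positivity)
  have e : (4 * N * ((C * √(4 * N)) * ((C * √(4 * N)) * (2 * π / 10)))) * π =
      M * N^2 * (π^2 * (32/4000)) := by
    calc _ = 4 * N * (C^2 * √(4 * (N:ℝ))^2 * (2 * π / 10)) * π := by ring
      _ = _ := by rw [hs, hC2]; ring
  rw [e] at hup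
  have hpi : π^2 < 16 := by nlinarith [pi_lt_four, pi_pos]
  have hMN : 0 < M * (N:ℝ)^2 := by positivity
  have : M * (N:ℝ)^2 * (28/100) ≤ M * (N:ℝ)^2 * (π^2 * (32/4000)) := by linarith
  have := le_of_mul_le_mul_left this hMN
  linarith
end

section
/- There exists an absolute constant C > 0 with the following property. Let N be a positive integer and let f : ℝ² → ℂ be zero outside the square [0,N] × [0,N] and constant, equal to z_{ij} ∈ ℂ, on each unit square (i,j) + [0,1)², 0 ≤ i,j < N. Then there is a straight line S in the plane such that |∫_S f| ≥ C N^{−1/2} (Σ_{i,j=0}^{N−1} |z_{ij}|²)^{1/2}, where ∫_S f is the integral of f along S with respect to one-dimensional (arc-length) measure. -/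
open MeasureTheory Real

/-- `∫_S f` where `S` is the straight line through the point `p` with unit direction `v`,
with respect to one-dimensional arc-length measure. -/
noncomputable def lineIntegral (f : EuclideanSpace ℝ (Fin 2) → ℂ)
    (p v : EuclideanSpace ℝ (Fin 2)) : ℂ :=
  ∫ s : ℝ, f (p + s • v)

open scoped FourierTransform

namespace LineDisc

lemma adj {f g : ℝ → ℂ} (hf : Integrable f) (hg : Integrable g) :
    ∫ ξ, 𝓕 f ξ * g ξ = ∫ x, f x * 𝓕 g x := by
  have := VectorFourier.integral_fourierIntegral_smul_eq_flip (L := innerₗ ℝ)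
      Real.continuous_fourierChar continuous_inner hf hg
  simpa [flip_innerₗ] using! this

lemma gauss_integrable : Integrable (fun x : ℝ => Real.exp (-π * x ^ 2)) :=
  integrable_exp_neg_mul_sq Real.pi_pos

lemma gauss_integral : ∫ x : ℝ, Real.exp (-π * x ^ 2) = 1 := by
  rw [integral_gaussian, div_self Real.pi_ne_zero, Real.sqrt_one]

lemma fourier_cont {g : ℝ → ℂ} (hg : Integrable g) : Continuous (𝓕 g) :=
  VectorFourier.fourierIntegral_continuous Real.continuous_fourierChar continuous_inner hg

lemma fourier_bdd (g : ℝ → ℂ) (x : ℝ) : ‖𝓕 g x‖ ≤ ∫ t, ‖g t‖ :=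
  VectorFourier.norm_fourierIntegral_le_integral_norm _ _ _ _ _

lemma gauss_mul_int {g : ℝ → ℂ} (hg : Integrable g) :
    Integrable (fun x : ℝ => Real.exp (-π * x ^ 2) * ‖𝓕 g x‖ ^ 2) := by
  refine (gauss_integrable.bdd_mul (c := (∫ t, ‖g t‖)^2) (f := fun x => ‖𝓕 g x‖ ^ 2) ?_ ?_).congr ?_
  · exact ((fourier_cont hg).norm.pow 2).aestronglyMeasurable
  · refine Filter.Eventually.of_forall fun x => ?_
    simp only [norm_pow, norm_norm]
    gcongr
    exact fourier_bdd g x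
  · exact Filter.Eventually.of_forall fun x => mul_comm _ _

lemma gauss_mul_int' {g : ℝ → ℂ} (hg : Integrable g) :
    Integrable (fun x : ℝ => (Real.exp (-π * x ^ 2) : ℂ) * (starRingEnd ℂ) (𝓕 g x)) := by
  refine (gauss_integrable.ofReal.bdd_mul (𝕜 := ℂ) (c := (∫ t, ‖g t‖))
    (f := fun x => (starRingEnd ℂ) (𝓕 g x)) ?_ ?_).congr ?_
  · exact (Complex.continuous_conj.comp (fourier_cont hg)).aestronglyMeasurable
  · refine Filter.Eventually.of_forall fun x => ?_
    rw [RCLike.norm_conj]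
    exact fourier_bdd g x
  · exact Filter.Eventually.of_forall fun x => mul_comm _ _

lemma inner_bound {g : ℝ → ℂ} {A : ℝ} (hg : Integrable g) (hA : ∀ x, ‖g x‖ ≤ A) (x : ℝ) :
    ‖𝓕 (fun η : ℝ => (Real.exp (-π * η ^ 2) : ℂ) * (starRingEnd ℂ) (𝓕 g η)) x‖ ≤ A := by
  set h : ℝ → ℂ := fun η => Complex.exp (-π * 1 * η ^ 2 + 2 * π * (Complex.I * x) * η) with hh
  have hhn : ∀ η, ‖h η‖ = Real.exp (-π * η ^ 2) := by
    intro η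
    rw [hh, Complex.norm_exp]
    congr 1
    simp [pow_two]
  have hhi : Integrable h := by
    refine gauss_integrable.mono' (by fun_prop) ?_
    exact Filter.Eventually.of_forall fun η => (hhn η).le
  have h1 : 𝓕 (fun η : ℝ => (Real.exp (-π * η ^ 2) : ℂ) * (starRingEnd ℂ) (𝓕 g η)) x
      = (starRingEnd ℂ) (∫ η, 𝓕 g η * h η) := by
    rw [← integral_conj, Real.fourier_real_eq_integral_exp_smul]
    congr 1; ext η
    simp only [hh, map_mul, smul_eq_mul, ← Complex.exp_conj]
    rw [← mul_assoc, mul_comm, Complex.ofReal_exp, ← Complex.exp_add]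
    congr 2
    simp [Complex.conj_ofNat]
    ring
  rw [h1, RCLike.norm_conj, adj hg hhi, hh, fourier_gaussian_pi' (by simp)]
  have h2 : ∀ t : ℝ, ‖g t * (1 / (1:ℂ) ^ (1 / 2 : ℂ) * Complex.exp (-π / 1 * (t + Complex.I * (Complex.I * x)) ^ 2))‖
      ≤ A * Real.exp (-π * (t - x) ^ 2) := by
    intro t
    rw [norm_mul]
    have : ‖(1 / (1:ℂ) ^ (1 / 2 : ℂ) * Complex.exp (-π / 1 * (t + Complex.I * (Complex.I * x)) ^ 2))‖ = Real.exp (-π * (t - x) ^ 2) := by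
      have e : (-π / 1 * (t + Complex.I * (Complex.I * x)) ^ 2 : ℂ) = ((-π * (t - x) ^ 2 : ℝ) : ℂ) := by
        rw [← mul_assoc, Complex.I_mul_I]; push_cast; ring
      rw [e, Complex.one_cpow, ← Complex.ofReal_exp, norm_mul, Complex.norm_real]
      simp
    rw [this]
    gcongr
    exact hA t
  refine (norm_integral_le_of_norm_le ?_ (Filter.Eventually.of_forall h2)).trans ?_
  · exact (gauss_integrable.comp_sub_right x).const_mul A
  · rw [integral_const_mul, integral_sub_right_eq_self (fun t : ℝ => Real.exp (-π * t ^ 2)) x, gauss_integral, mul_one]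

lemma gauss_bound {g : ℝ → ℂ} {A a L : ℝ} (hL : 0 ≤ L) (hg : Integrable g) (hA : ∀ x, ‖g x‖ ≤ A)
    (hs : ∀ x, x ∉ Set.Icc a (a + L) → g x = 0) :
    ∫ η : ℝ, Real.exp (-π * η ^ 2) * ‖𝓕 g η‖ ^ 2 ≤ A ^ 2 * L := by
  have hA0 : 0 ≤ A := (norm_nonneg _).trans (hA 0)
  have h1 : ((∫ η : ℝ, Real.exp (-π * η ^ 2) * ‖𝓕 g η‖ ^ 2 : ℝ) : ℂ) =
      ∫ x, g x * 𝓕 (fun η : ℝ => (Real.exp (-π * η ^ 2) : ℂ) * (starRingEnd ℂ) (𝓕 g η)) x := by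
    rw [← adj hg (gauss_mul_int' hg), ← integral_complex_ofReal]
    congr 1; ext η
    push_cast
    rw [← Complex.mul_conj']
    ring
  have h2 : ‖∫ x, g x * 𝓕 (fun η : ℝ => (Real.exp (-π * η ^ 2) : ℂ) * (starRingEnd ℂ) (𝓕 g η)) x‖ ≤ A ^ 2 * L := by
    rw [← setIntegral_eq_integral_of_forall_compl_eq_zero (s := Set.Icc a (a + L))
      (fun x hx => by rw [hs x hx, zero_mul])]
    refine (norm_setIntegral_le_of_norm_le_const (C := A ^ 2) (by simp) ?_).trans ?_
    · intro x _
      rw [norm_mul, pow_two]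
      gcongr
      · exact hA x
      · exact inner_bound hg hA x
    · simp [hL]
  rw [← h1] at h2
  exact (le_abs_self _).trans (by simpa only [Complex.norm_real] using! h2)


lemma shear_int {p q : ℝ → ℂ} (hp : Integrable p) (hq : Integrable q) (hpm : Measurable p)
    (hqm : Measurable q) (m : ℝ) :
    Integrable (fun w : ℝ × ℝ => p w.1 * q (m * w.1 + w.2)) (volume.prod volume) := by
  rw [integrable_prod_iff (by
    apply Measurable.aestronglyMeasurable
    fun_prop)]
  constructor
  · refine Filter.Eventually.of_forall fun x => ?_
    exact (hq.comp_add_left (m * x)).const_mul (p x)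
  · have : ∀ x : ℝ, ∫ b, ‖p x * q (m * x + b)‖ = ‖p x‖ * ∫ b, ‖q b‖ := by
      intro x
      simp_rw [norm_mul]
      rw [integral_const_mul, integral_add_left_eq_self (fun b => ‖q b‖) (m * x)]
    simp_rw [this]
    exact hp.norm.mul_const _

lemma exp_mul_int {q : ℝ → ℂ} (hq : Integrable q) (c : ℝ) :
    Integrable (fun x : ℝ => Complex.exp (↑(c * x) * Complex.I) * q x) := by
  refine hq.bdd_mul (c := 1) (by fun_prop) ?_
  exact Filter.Eventually.of_forall fun x => by rw [Complex.norm_exp_ofReal_mul_I]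

lemma slice {p q : ℝ → ℂ} (hp : Integrable p) (hq : Integrable q) (hpm : Measurable p)
    (hqm : Measurable q) (m η : ℝ) :
    𝓕 (fun b => ∫ x, p x * q (m * x + b)) η = 𝓕 p (-(m * η)) * 𝓕 q η := by
  set p' : ℝ → ℂ := fun x => Complex.exp (↑((2 * π * (m * η)) * x) * Complex.I) * p x with hp'
  set q' : ℝ → ℂ := fun x => Complex.exp (↑((-2 * π * η) * x) * Complex.I) * q x with hq'
  have h1 : 𝓕 p (-(m * η)) = ∫ x, p' x := by
    rw [Real.fourier_real_eq_integral_exp_smul]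
    congr 1; ext x
    simp only [hp', smul_eq_mul]
    congr 4; ring
  have h2 : 𝓕 q η = ∫ x, q' x := by
    rw [Real.fourier_real_eq_integral_exp_smul]
    congr 1; ext x
    simp only [hq', smul_eq_mul]
    congr 4; ring
  have hpi : Integrable p' := exp_mul_int hp _
  have hqi : Integrable q' := exp_mul_int hq _
  have hsi := shear_int hpi hqi (by fun_prop) (by fun_prop) m
  rw [h1, h2, Real.fourier_real_eq_integral_exp_smul]
  have h3 : ∀ b : ℝ, Complex.exp (↑(-2 * π * b * η) * Complex.I) • (∫ x, p x * q (m * x + b))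
      = ∫ x, p' x * q' (m * x + b) := by
    intro b
    rw [smul_eq_mul, ← integral_const_mul]
    congr 1; ext x
    simp only [hp', hq']
    have : Complex.exp (↑(-2 * π * b * η) * Complex.I) =
      Complex.exp (↑((2 * π * (m * η)) * x) * Complex.I) *
        Complex.exp (↑((-2 * π * η) * (m * x + b)) * Complex.I) := by
      rw [← Complex.exp_add]
      congr 1
      push_cast; ring
    rw [this]; ring
  simp_rw [h3]
  rw [← integral_integral_swap (f := fun x b => p' x * q' (m * x + b)) hsi]
  have h4 : ∀ x : ℝ, ∫ b, p' x * q' (m * x + b) = p' x * ∫ b, q' b := by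
    intro x
    rw [integral_const_mul, integral_add_left_eq_self q' (m * x)]
  simp_rw [h4]
  rw [integral_mul_const]

/-- Indicator of `[k, k+1)`. -/
noncomputable def ind (k : ℕ) : ℝ → ℂ := (Set.Ico (k : ℝ) (k + 1)).indicator (fun _ => 1)

lemma ind_meas (k : ℕ) : Measurable (ind k) := measurable_const.indicator measurableSet_Ico

lemma ind_int (k : ℕ) : Integrable (ind k) := by
  unfold ind
  rw [integrable_indicator_iff measurableSet_Ico]
  exact integrableOn_const (by simp)

lemma ind_norm_le (k : ℕ) (x : ℝ) : ‖ind k x‖ ≤ 1 := by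
  unfold ind
  rw [Set.indicator_apply]
  split_ifs <;> simp

lemma ind_shift (k : ℕ) (x : ℝ) : ind k (x + k) = ind 0 x := by
  unfold ind
  simp only [Set.indicator_apply, Set.mem_Ico]
  congr 1
  simp only [Nat.cast_zero, eq_iff_iff]
  constructor <;> rintro ⟨h1, h2⟩ <;> constructor <;> linarith

lemma fourier_ind (k : ℕ) (ξ : ℝ) :
    𝓕 (ind k) ξ = Complex.exp (↑(-2 * π * (k * ξ)) * Complex.I) * 𝓕 (ind 0) ξ := by
  rw [Real.fourier_real_eq_integral_exp_smul, Real.fourier_real_eq_integral_exp_smul,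
    ← integral_const_mul, ← integral_add_right_eq_self _ (k : ℝ)]
  congr 1; ext x
  rw [ind_shift, smul_eq_mul, smul_eq_mul, ← mul_assoc, ← Complex.exp_add]
  congr 2
  push_cast; ring

lemma fourier_ind_zero (ξ : ℝ) :
    𝓕 (ind 0) ξ = ∫ x in (0:ℝ)..1, Complex.exp ((↑(-2 * π * ξ) * Complex.I) * x) := by
  rw [Real.fourier_real_eq_integral_exp_smul, intervalIntegral.integral_of_le zero_le_one,
    ← integral_Ico_eq_integral_Ioc, ← integral_indicator measurableSet_Ico]
  congr 1; ext x
  simp only [ind, Set.indicator_apply, Nat.cast_zero, zero_add, smul_eq_mul]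
  split_ifs
  · rw [mul_one]; congr 1; push_cast; ring
  · rw [mul_zero]

lemma fourier_ind_lower {ξ : ℝ} (h : |ξ| ≤ 1 / 2) : 2 / π ≤ ‖𝓕 (ind 0) ξ‖ := by
  rw [fourier_ind_zero]
  by_cases h0 : ξ = 0
  · subst h0
    simp
    rw [div_le_one Real.pi_pos]
    exact Real.two_le_pi
  have hc : (↑(-2 * π * ξ) * Complex.I : ℂ) ≠ 0 := by
    simp [h0, Real.pi_ne_zero]
  rw [integral_exp_mul_complex hc]
  have e1 : ‖Complex.exp (↑(-2 * π * ξ) * Complex.I * ((1:ℝ):ℂ)) -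
      Complex.exp (↑(-2 * π * ξ) * Complex.I * ((0:ℝ):ℂ))‖ = 2 * |Real.sin (π * ξ)| := by
    have := Complex.norm_exp_I_mul_ofReal_sub_one (-2 * π * ξ)
    rw [Complex.ofReal_one, mul_one, Complex.ofReal_zero, mul_zero, Complex.exp_zero, mul_comm,
      this, norm_mul, show -2 * π * ξ / 2 = -(π * ξ) by ring, Real.sin_neg, norm_neg]
    simp
  have e2 : ‖(↑(-2 * π * ξ) * Complex.I : ℂ)‖ = 2 * (π * |ξ|) := by
    rw [norm_mul, Complex.norm_I, mul_one, Complex.norm_real, Real.norm_eq_abs, abs_mul, abs_mul,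
      abs_of_pos Real.pi_pos]
    norm_num
    ring
  have hpos : 0 < |ξ| := abs_pos.2 h0
  rw [norm_div, e1, e2, le_div_iff₀ (by positivity)]
  have h3 : 2 / π * (π * |ξ|) ≤ Real.sin (π * |ξ|) :=
    Real.mul_le_sin (by positivity) (by nlinarith [Real.pi_pos])
  have h4 : Real.sin (π * |ξ|) ≤ |Real.sin (π * ξ)| := by
    rcases abs_cases ξ with ⟨h, _⟩ | ⟨h, _⟩ <;> rw [h]
    · exact le_abs_self _
    · rw [mul_neg, Real.sin_neg]; exact neg_le_abs _
  linarith

lemma orth (n : ℤ) : ∫ ξ in (-(1/2) : ℝ)..(1/2), Complex.exp ((2 * π * n * Complex.I) * ξ)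
    = if n = 0 then 1 else 0 := by
  split_ifs with h
  · subst h; simp; norm_num
  · have hc : (2 * π * n * Complex.I : ℂ) ≠ 0 := by
      simp [h, Real.pi_ne_zero]
    rw [integral_exp_mul_complex hc]
    have : Complex.exp (2 * π * n * Complex.I * ((1/2 : ℝ) : ℂ)) =
        Complex.exp (2 * π * n * Complex.I * ((-(1/2) : ℝ) : ℂ)) := by
      rw [Complex.exp_eq_exp_iff_exists_int]
      refine ⟨n, ?_⟩
      push_cast; ring
    rw [this, sub_self, zero_div]

lemma parseval {N : ℕ} (a : Fin N → ℂ) :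
    ∫ ξ in (-(1/2) : ℝ)..(1/2), ‖∑ i, a i * Complex.exp (↑(-2 * π * (i * ξ)) * Complex.I)‖ ^ 2
      = ∑ i, ‖a i‖ ^ 2 := by
  have key : ∀ ξ : ℝ, ((‖∑ i, a i * Complex.exp (↑(-2 * π * (i * ξ)) * Complex.I)‖ ^ 2 : ℝ) : ℂ)
      = ∑ i, ∑ k, a i * (starRingEnd ℂ) (a k) *
          Complex.exp ((2 * π * (((k : ℕ) : ℤ) - ((i : ℕ) : ℤ) : ℤ) * Complex.I) * ξ) := by
    intro ξ
    push_cast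
    rw [← Complex.mul_conj', map_sum, Finset.sum_mul_sum]
    refine Finset.sum_congr rfl fun i _ => Finset.sum_congr rfl fun k _ => ?_
    rw [map_mul, ← Complex.exp_conj, mul_mul_mul_comm, ← Complex.exp_add]
    congr 2
    simp [Complex.conj_ofNat]
    ring
  apply Complex.ofReal_injective
  rw [← intervalIntegral.integral_ofReal]
  simp_rw [key]
  rw [intervalIntegral.integral_finsetSum
    (fun i _ => Continuous.intervalIntegrable (by fun_prop) _ _)]
  rw [Complex.ofReal_sum]
  refine Finset.sum_congr rfl fun i _ => ?_
  rw [intervalIntegral.integral_finsetSum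
    (fun i _ => Continuous.intervalIntegrable (by fun_prop) _ _)]
  simp_rw [intervalIntegral.integral_const_mul, orth]
  rw [Finset.sum_eq_single i]
  · simp [Complex.mul_conj']
  · intro k _ hk
    rw [if_neg, mul_zero]
    intro h
    apply hk
    ext
    omega
  · simp

/-- The trigonometric polynomial attached to `z`. -/
noncomputable def Z {N : ℕ} (z : Fin N → Fin N → ℂ) (ξ η : ℝ) : ℂ :=
  ∑ i : Fin N, (∑ j : Fin N, z i j * Complex.exp (↑(-2 * π * ((j : ℕ) * η)) * Complex.I)) *
    Complex.exp (↑(-2 * π * ((i : ℕ) * ξ)) * Complex.I)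

lemma Z_cont {N : ℕ} (z : Fin N → Fin N → ℂ) : Continuous (Function.uncurry (Z z)) := by
  unfold Z Function.uncurry
  fun_prop

lemma Z_transpose {N : ℕ} (z : Fin N → Fin N → ℂ) (ξ η : ℝ) :
    Z (fun i j => z j i) ξ η = Z z η ξ := by
  unfold Z
  simp_rw [Finset.sum_mul]
  rw [Finset.sum_comm]
  refine Finset.sum_congr rfl fun i _ => Finset.sum_congr rfl fun k _ => ?_
  ring

lemma parseval_two {N : ℕ} (z : Fin N → Fin N → ℂ) :
    ∫ η in (-(1/2) : ℝ)..(1/2), ∫ ξ in (-(1/2) : ℝ)..(1/2), ‖Z z ξ η‖ ^ 2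
      = ∑ i, ∑ j, ‖z i j‖ ^ 2 := by
  unfold Z
  simp_rw [parseval]
  rw [intervalIntegral.integral_finsetSum
    (fun i _ => Continuous.intervalIntegrable (by fun_prop) _ _)]
  simp_rw [parseval]

/-- The step function. -/
noncomputable def F {N : ℕ} (z : Fin N → Fin N → ℂ) (x y : ℝ) : ℂ :=
  ∑ i : Fin N, ∑ j : Fin N, z i j * (ind i x * ind j y)

lemma G_eq {N : ℕ} (z : Fin N → Fin N → ℂ) (m b : ℝ) :
    ∫ x, F z x (m * x + b) =
      ∑ i : Fin N, ∑ j : Fin N, z i j * ∫ x, ind i x * ind j (m * x + b) := by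
  have hi : ∀ i j : Fin N, Integrable (fun x => z i j * (ind i x * ind j (m * x + b))) := by
    intro i j
    refine Integrable.const_mul ?_ _
    refine ((ind_int i).bdd_mul (f := fun x => ind j (m * x + b)) (c := 1) ?_ ?_).congr ?_
    · exact ((ind_meas j).comp (by fun_prop)).aestronglyMeasurable
    · exact Filter.Eventually.of_forall fun x => ind_norm_le _ _
    · exact Filter.Eventually.of_forall fun x => mul_comm _ _
  unfold F
  rw [integral_finsetSum _ (fun i _ => integrable_finsetSum _ fun j _ => hi i j)]
  refine Finset.sum_congr rfl fun i _ => ?_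
  rw [integral_finsetSum _ (fun j _ => hi i j)]
  simp_rw [integral_const_mul]

lemma cell_int (m : ℝ) (i j : ℕ) : Integrable (fun b => ∫ x, ind i x * ind j (m * x + b)) :=
  (shear_int (ind_int i) (ind_int j) (ind_meas i) (ind_meas j) m).integral_prod_right

lemma G_int {N : ℕ} (z : Fin N → Fin N → ℂ) (m : ℝ) :
    Integrable (fun b => ∫ x, F z x (m * x + b)) := by
  simp_rw [G_eq]
  exact integrable_finsetSum _ fun i _ => integrable_finsetSum _ fun j _ =>
    (cell_int m i j).const_mul _

lemma G_fourier {N : ℕ} (z : Fin N → Fin N → ℂ) (m η : ℝ) :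
    𝓕 (fun b => ∫ x, F z x (m * x + b)) η =
      Z z (-(m * η)) η * (𝓕 (ind 0) (-(m * η)) * 𝓕 (ind 0) η) := by
  have h : ∀ i j : ℕ, ∫ b : ℝ, Complex.exp (↑(-2 * π * b * η) * Complex.I) *
      (∫ x, ind i x * ind j (m * x + b)) = 𝓕 (ind i) (-(m * η)) * 𝓕 (ind j) η := by
    intro i j
    rw [← slice (ind_int i) (ind_int j) (ind_meas i) (ind_meas j),
      Real.fourier_real_eq_integral_exp_smul]
    rfl
  have hi : ∀ i j : Fin N, Integrable (fun b : ℝ => z i j * (Complex.exp (↑(-2 * π * b * η) * Complex.I) *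
      (∫ x, ind i x * ind j (m * x + b)))) := by
    intro i j
    refine Integrable.const_mul ?_ _
    refine (exp_mul_int (cell_int m i j) (-2 * π * η)).congr ?_
    refine Filter.Eventually.of_forall fun b => ?_
    simp only
    congr 4; ring
  rw [Real.fourier_real_eq_integral_exp_smul]
  simp_rw [G_eq, smul_eq_mul, Finset.mul_sum, mul_left_comm _ (z _ _)]
  rw [integral_finsetSum _ (fun i _ => integrable_finsetSum _ fun j _ => hi i j)]
  unfold Z
  simp_rw [Finset.sum_mul]
  refine Finset.sum_congr rfl fun i _ => ?_
  rw [integral_finsetSum _ (fun j _ => hi i j)]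
  refine Finset.sum_congr rfl fun j _ => ?_
  rw [integral_const_mul, h, fourier_ind i, fourier_ind j]
  ring

lemma ind_of_mem {k : ℕ} {x : ℝ} (h1 : (k : ℝ) ≤ x) (h2 : x < k + 1) : ind k x = 1 := by
  unfold ind
  exact Set.indicator_of_mem (Set.mem_Ico.2 ⟨h1, h2⟩) _

lemma mem_of_ind {k : ℕ} {x : ℝ} (h : ind k x ≠ 0) : (k : ℝ) ≤ x ∧ x < k + 1 := by
  by_contra hc
  exact h (Set.indicator_of_notMem (by simpa using hc) _)

lemma F_ne_zero {N : ℕ} {z : Fin N → Fin N → ℂ} {x y : ℝ} (h : F z x y ≠ 0) :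
    0 ≤ x ∧ x < N ∧ 0 ≤ y ∧ y < N := by
  unfold F at h
  obtain ⟨i, _, hi⟩ := Finset.exists_ne_zero_of_sum_ne_zero h
  obtain ⟨j, _, hj⟩ := Finset.exists_ne_zero_of_sum_ne_zero hi
  have h1 := mem_of_ind (left_ne_zero_of_mul (right_ne_zero_of_mul hj))
  have h2 := mem_of_ind (right_ne_zero_of_mul (right_ne_zero_of_mul hj))
  have hi' : ((i : ℕ) : ℝ) + 1 ≤ N := by exact_mod_cast i.2
  have hj' : ((j : ℕ) : ℝ) + 1 ≤ N := by exact_mod_cast j.2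
  have hi0 : (0 : ℝ) ≤ (i : ℕ) := Nat.cast_nonneg _
  have hj0 : (0 : ℝ) ≤ (j : ℕ) := Nat.cast_nonneg _
  refine ⟨?_, ?_, ?_, ?_⟩ <;> linarith [h1.1, h1.2, h2.1, h2.2]

lemma F_eq {N : ℕ} (z : Fin N → Fin N → ℂ) {x y : ℝ} (i j : Fin N) (h1 : ((i : ℕ) : ℝ) ≤ x)
    (h2 : x < (i : ℕ) + 1) (h3 : ((j : ℕ) : ℝ) ≤ y) (h4 : y < (j : ℕ) + 1) : F z x y = z i j := by
  have aux : ∀ (i k : Fin N) (x : ℝ), ((i : ℕ) : ℝ) ≤ x → x < (i : ℕ) + 1 → k ≠ i →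
      ind k x = 0 := by
    intro i k x h1 h2 hk
    by_contra hne
    obtain ⟨h3, h4⟩ := mem_of_ind hne
    apply hk
    ext
    have a1 : ((i : ℕ) : ℝ) < (k : ℕ) + 1 := by linarith
    have a2 : ((k : ℕ) : ℝ) < (i : ℕ) + 1 := by linarith
    norm_cast at a1 a2
    omega
  unfold F
  rw [Finset.sum_eq_single i, Finset.sum_eq_single j, ind_of_mem h1 h2, ind_of_mem h3 h4]
  · simp
  · intro k _ hk
    rw [aux j k y h3 h4 hk]; simp
  · simp
  · intro k _ hk
    rw [aux i k x h1 h2 hk]; simp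
  · simp

lemma G_zero {N : ℕ} (z : Fin N → Fin N → ℂ) {m : ℝ} (hm : |m| ≤ 1) (b : ℝ)
    (hb : b ∉ Set.Icc (-(N : ℝ)) (-N + 3 * N)) : ∫ x, F z x (m * x + b) = 0 := by
  have : ∀ x, F z x (m * x + b) = 0 := by
    intro x
    by_contra h
    obtain ⟨h1, h2, h3, h4⟩ := F_ne_zero h
    apply hb
    obtain ⟨h5, h6⟩ := abs_le.1 hm
    constructor <;> nlinarith
  simp [this]

/-- The constant. -/
noncomputable def K : ℝ := Real.exp (-π / 4) * (2 / π) ^ 4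

lemma K_pos : 0 < K := by unfold K; positivity

lemma core_slope {N : ℕ} (z : Fin N → Fin N → ℂ) {A m : ℝ} (hm : |m| ≤ 1)
    (hA : ∀ b, ‖∫ x, F z x (m * x + b)‖ ≤ A) :
    ∫ η in (-(1/2) : ℝ)..(1/2), ‖Z z (-(m * η)) η‖ ^ 2 ≤ 3 * N * A ^ 2 / K := by
  have h1 := gauss_bound (a := -(N : ℝ)) (L := 3 * N) (by positivity) (G_int z m) hA (G_zero z hm)
  rw [le_div_iff₀ K_pos, ← intervalIntegral.integral_mul_const]
  refine le_trans ?_ (h1.trans (by linarith))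
  rw [intervalIntegral.integral_of_le (by norm_num)]
  refine le_trans ?_ (setIntegral_le_integral (s := Set.Ioc (-(1/2):ℝ) (1/2))
    (gauss_mul_int (G_int z m)) (Filter.Eventually.of_forall fun η => by simp only [Pi.zero_apply]; positivity))
  refine setIntegral_mono_on ?_ (gauss_mul_int (G_int z m)).integrableOn measurableSet_Ioc ?_
  · have hc : Continuous (fun η : ℝ => ‖Z z (-(m * η)) η‖ ^ 2 * K) := by
      have := (Z_cont z).comp (f := fun η : ℝ => (-(m * η), η)) (by fun_prop)
      exact (this.norm.pow 2).mul continuous_const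
    exact (hc.integrableOn_Icc).mono_set Set.Ioc_subset_Icc_self
  · intro η hη
    have h2 : |η| ≤ 1 / 2 := abs_le.2 ⟨hη.1.le, hη.2⟩
    have h3 : |-(m * η)| ≤ 1 / 2 := by
      rw [abs_neg, abs_mul]
      nlinarith [abs_nonneg m, abs_nonneg η]
    rw [G_fourier, norm_mul, norm_mul, mul_pow, mul_pow]
    have u1 := fourier_ind_lower h2
    have u2 := fourier_ind_lower h3
    have hexp : Real.exp (-π / 4) ≤ Real.exp (-π * η ^ 2) := by
      apply Real.exp_le_exp.2
      have : η ^ 2 ≤ 1 / 4 := by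
        rw [← sq_abs]; nlinarith [abs_nonneg η]
      nlinarith [Real.pi_pos]
    have hq : (2 / π) ^ 4 ≤ ‖𝓕 (ind 0) (-(m * η))‖ ^ 2 * ‖𝓕 (ind 0) η‖ ^ 2 := by
      calc (2 / π) ^ 4 = (2 / π) ^ 2 * (2 / π) ^ 2 := by ring
        _ ≤ _ := by gcongr
    calc ‖Z z (-(m * η)) η‖ ^ 2 * K
        ≤ ‖Z z (-(m * η)) η‖ ^ 2 * (Real.exp (-π * η ^ 2) *
          (‖𝓕 (ind 0) (-(m * η))‖ ^ 2 * ‖𝓕 (ind 0) η‖ ^ 2)) := by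
          unfold K; gcongr
      _ = _ := by ring

/-- The half-open unit square. -/
def Q : Set (ℝ × ℝ) := Set.Ioc (-(1/2) : ℝ) (1/2) ×ˢ Set.Ioc (-(1/2) : ℝ) (1/2)

lemma Q_meas : MeasurableSet Q := measurableSet_Ioc.prod measurableSet_Ioc

lemma cont_Q {h : ℝ × ℝ → ℝ} (hc : Continuous h) : IntegrableOn h Q (volume.prod volume) :=
  (hc.continuousOn.integrableOn_compact (μ := volume.prod volume)
    ((isCompact_Icc (a := (-(1/2) : ℝ)) (b := 1/2)).prod
      (isCompact_Icc (a := (-(1/2) : ℝ)) (b := 1/2)))).mono_set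
    (Set.prod_mono Set.Ioc_subset_Icc_self Set.Ioc_subset_Icc_self)

/-- The triangle indicator. -/
def T : Set (ℝ × ℝ) := {p | |p.2| ≤ |p.1|}

lemma T_meas : MeasurableSet T :=
  measurableSet_le (by fun_prop) (by fun_prop)

lemma inner_tri {ψ : ℝ → ℝ} (hc : Continuous ψ) (h0 : ∀ x, 0 ≤ ψ x) {η : ℝ} (hη : |η| ≤ 1 / 2) :
    ∫ ξ in Set.Ioc (-(1/2) : ℝ) (1/2), {ξ : ℝ | |ξ| ≤ |η|}.indicator ψ ξ ≤
      1 / 2 * ∫ m in (-1 : ℝ)..1, ψ (-(m * η)) := by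
  have hset : {ξ : ℝ | |ξ| ≤ |η|} = Set.Icc (-|η|) |η| := by
    ext x; simp [abs_le]
  have e0 : ∀ s : ℝ, s * ∫ m in (-1 : ℝ)..1, ψ (m * s) = ∫ ξ in (-s)..s, ψ ξ := by
    intro s
    rw [intervalIntegral.mul_integral_comp_mul_right]; simp
  have e1 : |η| * ∫ m in (-1 : ℝ)..1, ψ (-(m * η)) = ∫ ξ in (-|η|)..|η|, ψ ξ := by
    rcases abs_cases η with ⟨h, _⟩ | ⟨h, _⟩
    · rw [h, ← e0]
      congr 1
      have := intervalIntegral.integral_comp_neg (a := (-1 : ℝ)) (b := 1) (fun m => ψ (m * η))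
      simpa using! this
    · rw [h, ← e0]
      simp
  have hnn : 0 ≤ ∫ m in (-1 : ℝ)..1, ψ (-(m * η)) :=
    intervalIntegral.integral_nonneg (by norm_num) fun _ _ => h0 _
  refine le_trans ?_ (mul_le_mul_of_nonneg_right hη hnn)
  rw [e1, hset, setIntegral_indicator measurableSet_Icc,
    intervalIntegral.integral_of_le (by linarith [abs_nonneg η]), ← integral_Icc_eq_integral_Ioc]
  refine setIntegral_mono_set hc.integrableOn_Icc (Filter.Eventually.of_forall fun x => h0 x) ?_
  exact (Set.inter_subset_right).eventuallyLE

lemma tri {φ : ℝ → ℝ → ℝ} (hc : Continuous (Function.uncurry φ)) (h0 : ∀ x y, 0 ≤ φ x y) :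
    ∫ p in Q, T.indicator (fun p => φ p.2 p.1) p ∂(volume.prod volume) ≤
      1 / 2 * ∫ m in (-1 : ℝ)..1, ∫ η in (-(1/2) : ℝ)..(1/2), φ (-(m * η)) η := by
  have hc1 : Continuous (fun p : ℝ × ℝ => φ p.2 p.1) := hc.comp continuous_swap
  have hc2 : Continuous (fun p : ℝ × ℝ => φ (-(p.2 * p.1)) p.1) :=
    hc.comp (f := fun p : ℝ × ℝ => (-(p.2 * p.1), p.1)) (by fun_prop)
  have hTQ : IntegrableOn (T.indicator (fun p => φ p.2 p.1)) Q (volume.prod volume) :=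
    (cont_Q hc1).indicator T_meas
  have hsw : ∫ m in (-1 : ℝ)..1, ∫ η in (-(1/2) : ℝ)..(1/2), φ (-(m * η)) η
      = ∫ η in (-(1/2) : ℝ)..(1/2), ∫ m in (-1 : ℝ)..1, φ (-(m * η)) η := by
    refine intervalIntegral_intervalIntegral_swap (F := fun m η => φ (-(m * η)) η) ?_
    have hc3 : Continuous (fun p : ℝ × ℝ => φ (-(p.1 * p.2)) p.2) :=
      hc.comp (f := fun p : ℝ × ℝ => (-(p.1 * p.2), p.2)) (by fun_prop)
    rw [Set.uIoc_of_le (by norm_num), Set.uIoc_of_le (by norm_num)]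
    exact (hc3.continuousOn.integrableOn_compact (μ := volume.prod volume)
      ((isCompact_Icc (a := (-1 : ℝ)) (b := 1)).prod
        (isCompact_Icc (a := (-(1/2) : ℝ)) (b := 1/2)))).mono_set
      (Set.prod_mono Set.Ioc_subset_Icc_self Set.Ioc_subset_Icc_self)
  rw [hsw, ← intervalIntegral.integral_const_mul, intervalIntegral.integral_of_le (by norm_num)]
  unfold Q at hTQ ⊢
  rw [setIntegral_prod _ hTQ]
  have hcI : Continuous (fun η : ℝ => ∫ m in (-1 : ℝ)..1, φ (-(m * η)) η) :=
    intervalIntegral.continuous_parametric_intervalIntegral_of_continuous'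
      (f := fun η m : ℝ => φ (-(m * η)) η) hc2 _ _
  refine setIntegral_mono_on ?_ ?_ measurableSet_Ioc ?_
  · rw [IntegrableOn, ← Measure.prod_restrict] at hTQ
    exact hTQ.integral_prod_left
  · exact ((continuous_const.mul hcI).integrableOn_Icc).mono_set Set.Ioc_subset_Icc_self
  · intro η hη
    exact inner_tri (ψ := fun ξ => φ ξ η)
      (hc.comp (f := fun ξ : ℝ => (ξ, η)) (by fun_prop)) (fun x => h0 x η)
      (abs_le.2 ⟨hη.1.le, hη.2⟩)

lemma square {φ : ℝ → ℝ → ℝ} (hc : Continuous (Function.uncurry φ)) (h0 : ∀ x y, 0 ≤ φ x y) :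
    ∫ η in (-(1/2) : ℝ)..(1/2), ∫ ξ in (-(1/2) : ℝ)..(1/2), φ ξ η ≤
      1 / 2 * (∫ m in (-1 : ℝ)..1, ∫ η in (-(1/2) : ℝ)..(1/2), φ (-(m * η)) η) +
      1 / 2 * (∫ m in (-1 : ℝ)..1, ∫ η in (-(1/2) : ℝ)..(1/2), φ η (-(m * η))) := by
  have hc1 : Continuous (fun p : ℝ × ℝ => φ p.2 p.1) := hc.comp continuous_swap
  have t1 := tri hc h0
  have t2 := tri (φ := fun x y => φ y x) hc1 (fun x y => h0 y x)
  have e : ∫ η in (-(1/2) : ℝ)..(1/2), ∫ ξ in (-(1/2) : ℝ)..(1/2), φ ξ η =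
      ∫ p in Q, φ p.2 p.1 ∂(volume.prod volume) := by
    unfold Q
    rw [setIntegral_prod _ (cont_Q hc1)]
    simp_rw [intervalIntegral.integral_of_le (show (-(1/2) : ℝ) ≤ 1/2 by norm_num)]
  have e2 : ∫ p in Q, T.indicator (fun p => φ p.1 p.2) p ∂(volume.prod volume) =
      ∫ p in Q, (Prod.swap ⁻¹' T).indicator (fun p => φ p.2 p.1) p ∂(volume.prod volume) := by
    unfold Q
    rw [← setIntegral_prod_swap]
    rfl
  have i1 : IntegrableOn (T.indicator (fun p => φ p.2 p.1)) Q (volume.prod volume) :=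
    (cont_Q hc1).indicator T_meas
  have i2 : IntegrableOn ((Prod.swap ⁻¹' T).indicator (fun p => φ p.2 p.1)) Q
      (volume.prod volume) :=
    (cont_Q hc1).indicator (measurable_swap T_meas)
  rw [e]
  refine le_trans ?_ (add_le_add t1 t2)
  rw [e2, ← integral_add i1 i2]
  refine setIntegral_mono_on (cont_Q hc1) (i1.add i2) Q_meas ?_
  intro p _
  rcases le_total |p.2| |p.1| with h | h
  · have h' : p ∈ T := h
    rw [Set.indicator_of_mem h']
    exact le_add_of_nonneg_right (Set.indicator_nonneg (fun p _ => h0 _ _) _)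
  · have h' : p ∈ Prod.swap ⁻¹' T := h
    rw [Set.indicator_of_mem h']
    exact le_add_of_nonneg_left (Set.indicator_nonneg (fun p _ => h0 _ _) _)

lemma core {N : ℕ} (z : Fin N → Fin N → ℂ) {A : ℝ}
    (hA : ∀ m b, m ≠ 0 → ‖∫ x, F z x (m * x + b)‖ ≤ A) :
    ∫ m in (-1 : ℝ)..1, ∫ η in (-(1/2) : ℝ)..(1/2), ‖Z z (-(m * η)) η‖ ^ 2
      ≤ 2 * (3 * N * A ^ 2 / K) := by
  have hc : Continuous (fun m : ℝ => ∫ η in (-(1/2) : ℝ)..(1/2), ‖Z z (-(m * η)) η‖ ^ 2) := by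
    refine intervalIntegral.continuous_parametric_intervalIntegral_of_continuous'
      (f := fun m η : ℝ => ‖Z z (-(m * η)) η‖ ^ 2) ?_ _ _
    exact ((Z_cont z).comp (f := fun p : ℝ × ℝ => (-(p.1 * p.2), p.2)) (by fun_prop)).norm.pow 2
  have e : 2 * (3 * N * A ^ 2 / K) = ∫ m in (-1 : ℝ)..1, 3 * N * A ^ 2 / K := by
    rw [intervalIntegral.integral_const, smul_eq_mul]; norm_num
  rw [e, intervalIntegral.integral_of_le (by norm_num), intervalIntegral.integral_of_le (by norm_num)]
  refine setIntegral_mono_on_ae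
    ((hc.integrableOn_Icc).mono_set Set.Ioc_subset_Icc_self)
    ((continuous_const.integrableOn_Icc).mono_set Set.Ioc_subset_Icc_self) measurableSet_Ioc ?_
  filter_upwards [Measure.ae_ne volume (0 : ℝ)] with m hm hmem
  exact core_slope z (abs_le.2 ⟨hmem.1.le, hmem.2⟩) (fun b => hA m b hm)

lemma sum_bound {N : ℕ} (z : Fin N → Fin N → ℂ) {A : ℝ}
    (hA : ∀ m b, m ≠ 0 → ‖∫ x, F z x (m * x + b)‖ ≤ A)
    (hA' : ∀ m b, m ≠ 0 → ‖∫ x, F z (m * x + b) x‖ ≤ A) :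
    ∑ i, ∑ j, ‖z i j‖ ^ 2 ≤ 6 * N * A ^ 2 / K := by
  have hT : ∀ x y, F (fun i j => z j i) x y = F z y x := by
    intro x y
    unfold F
    rw [Finset.sum_comm]
    refine Finset.sum_congr rfl fun i _ => Finset.sum_congr rfl fun k _ => ?_
    ring
  have c1 := core z hA
  have c2 := core (fun i j => z j i) (A := A) (by simpa only [hT] using hA')
  simp_rw [Z_transpose] at c2
  have hcz : Continuous (Function.uncurry fun ξ η => ‖Z z ξ η‖ ^ 2) := (Z_cont z).norm.pow 2
  have hs := square (φ := fun ξ η => ‖Z z ξ η‖ ^ 2) hcz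
    (fun _ _ => by positivity)
  rw [parseval_two] at hs
  have : 6 * N * A ^ 2 / K = 2 * (3 * N * A ^ 2 / K) := by ring
  rw [this]
  linarith

lemma line_bound {f : EuclideanSpace ℝ (Fin 2) → ℂ} {A : ℝ}
    (h : ∀ p v : EuclideanSpace ℝ (Fin 2), ‖v‖ = 1 → ‖lineIntegral f p v‖ ≤ A)
    (p d : EuclideanSpace ℝ (Fin 2)) (hd : 1 ≤ ‖d‖) : ‖∫ x : ℝ, f (p + x • d)‖ ≤ A := by
  have hd0 : 0 < ‖d‖ := by linarith
  have h1 := h p (‖d‖⁻¹ • d) (by rw [norm_smul, norm_inv, norm_norm, inv_mul_cancel₀ hd0.ne'])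
  unfold lineIntegral at h1
  have e : ∫ s : ℝ, f (p + s • ‖d‖⁻¹ • d) = ‖d‖ • ∫ x : ℝ, f (p + x • d) := by
    have := Measure.integral_comp_mul_right (fun x : ℝ => f (p + x • d)) ‖d‖⁻¹
    rw [inv_inv, abs_of_pos hd0] at this
    rw [← this]
    simp_rw [smul_smul]
  rw [e, norm_smul, norm_norm] at h1
  nlinarith [norm_nonneg (∫ x : ℝ, f (p + x • d))]

lemma f_eq {N : ℕ} {z : Fin N → Fin N → ℂ} {f : EuclideanSpace ℝ (Fin 2) → ℂ}
    (h0 : ∀ x : EuclideanSpace ℝ (Fin 2),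
      ¬ (0 ≤ x 0 ∧ x 0 ≤ N ∧ 0 ≤ x 1 ∧ x 1 ≤ N) → f x = 0)
    (h1 : ∀ (i j : Fin N) (x : EuclideanSpace ℝ (Fin 2)),
      (i : ℝ) ≤ x 0 → x 0 < i + 1 → (j : ℝ) ≤ x 1 → x 1 < j + 1 → f x = z i j)
    (x : EuclideanSpace ℝ (Fin 2)) (hx : x 0 ≠ N) (hy : x 1 ≠ N) : f x = F z (x 0) (x 1) := by
  by_cases hin : 0 ≤ x 0 ∧ x 0 ≤ N ∧ 0 ≤ x 1 ∧ x 1 ≤ N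
  · obtain ⟨a1, a2, a3, a4⟩ := hin
    have b2 := lt_of_le_of_ne a2 hx
    have b4 := lt_of_le_of_ne a4 hy
    have hi : ⌊x 0⌋₊ < N := (Nat.floor_lt a1).2 b2
    have hj : ⌊x 1⌋₊ < N := (Nat.floor_lt a3).2 b4
    rw [h1 ⟨_, hi⟩ ⟨_, hj⟩ x (Nat.floor_le a1) (Nat.lt_floor_add_one _) (Nat.floor_le a3)
      (Nat.lt_floor_add_one _)]
    exact (F_eq z ⟨_, hi⟩ ⟨_, hj⟩ (Nat.floor_le a1) (Nat.lt_floor_add_one _) (Nat.floor_le a3)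
      (Nat.lt_floor_add_one _)).symm
  · rw [h0 x hin]
    by_contra hne
    obtain ⟨a1, a2, a3, a4⟩ := F_ne_zero (Ne.symm hne)
    exact hin ⟨a1, a2.le, a3, a4.le⟩

lemma ae_line (m b N : ℝ) (hm : m ≠ 0) : ∀ᵐ x : ℝ, m * x + b ≠ N := by
  filter_upwards [Measure.ae_ne volume ((N - b) / m)] with x hx h
  apply hx
  rw [eq_div_iff hm]; linarith

lemma norm_ge (d : EuclideanSpace ℝ (Fin 2)) (i : Fin 2) (h : d i = 1) : 1 ≤ ‖d‖ := by
  have := PiLp.norm_apply_le d i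
  rwa [h, norm_one] at this

end LineDisc

/-- For any step function `f` on the `N × N` checkerboard with cell values `z i j`,
there is a straight line `S` with `|∫_S f| ≥ C N^{-1/2} (Σ |z i j|²)^{1/2}`. -/
theorem line_discrepancy_lower_bound :
    ∃ C : ℝ, 0 < C ∧
      ∀ (N : ℕ), 0 < N →
        ∀ (z : Fin N → Fin N → ℂ) (f : EuclideanSpace ℝ (Fin 2) → ℂ),
          (∀ x : EuclideanSpace ℝ (Fin 2),
            ¬ (0 ≤ x 0 ∧ x 0 ≤ N ∧ 0 ≤ x 1 ∧ x 1 ≤ N) → f x = 0) →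
          (∀ (i j : Fin N) (x : EuclideanSpace ℝ (Fin 2)),
            (i : ℝ) ≤ x 0 → x 0 < i + 1 → (j : ℝ) ≤ x 1 → x 1 < j + 1 → f x = z i j) →
          ∃ p v : EuclideanSpace ℝ (Fin 2), ‖v‖ = 1 ∧
            C * (N : ℝ) ^ (-(1/2 : ℝ)) * Real.sqrt (∑ i, ∑ j, ‖z i j‖ ^ 2)
              ≤ ‖lineIntegral f p v‖ := by
  have hK := LineDisc.K_pos
  refine ⟨Real.sqrt (LineDisc.K / 12), by positivity, ?_⟩
  intro N hN z f h0 h1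
  by_contra! hcon
  set S : ℝ := ∑ i, ∑ j, ‖z i j‖ ^ 2 with hS
  set A : ℝ := Real.sqrt (LineDisc.K / 12) * (N : ℝ) ^ (-(1/2 : ℝ)) * Real.sqrt S with hA
  have hNr : (0 : ℝ) < N := by exact_mod_cast hN
  have hS0 : 0 ≤ S := by positivity
  have hb := fun p d => LineDisc.line_bound (f := f) (A := A) (fun p v hv => (hcon p v hv).le) p d
  have b1 : ∀ m b, m ≠ 0 → ‖∫ x, LineDisc.F z x (m * x + b)‖ ≤ A := by
    intro m b hm
    have := hb !₂[0, b] !₂[1, m] (LineDisc.norm_ge _ 0 (by simp))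
    rwa [integral_congr_ae (g := fun x => LineDisc.F z x (m * x + b))] at this
    filter_upwards [Measure.ae_ne volume (N : ℝ), LineDisc.ae_line m b N hm] with x hx hy
    rw [LineDisc.f_eq h0 h1 _ (by simpa using hx) (by simpa [add_comm, mul_comm] using hy)]
    simp [add_comm, mul_comm]
  have b2 : ∀ m b, m ≠ 0 → ‖∫ x, LineDisc.F z (m * x + b) x‖ ≤ A := by
    intro m b hm
    have := hb !₂[b, 0] !₂[m, 1] (LineDisc.norm_ge _ 1 (by simp))
    rwa [integral_congr_ae (g := fun x => LineDisc.F z (m * x + b) x)] at this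
    filter_upwards [Measure.ae_ne volume (N : ℝ), LineDisc.ae_line m b N hm] with x hx hy
    rw [LineDisc.f_eq h0 h1 _ (by simpa [add_comm, mul_comm] using hy) (by simpa using hx)]
    simp [add_comm, mul_comm]
  have hfin := LineDisc.sum_bound z b1 b2
  have hpos : 0 < A := by
    obtain ⟨v, hv⟩ : ∃ v : EuclideanSpace ℝ (Fin 2), ‖v‖ = 1 :=
      ⟨EuclideanSpace.single 0 1, by simp⟩
    exact (norm_nonneg _).trans_lt (hcon 0 v hv)
  have hA2 : N * A ^ 2 = LineDisc.K / 12 * S := by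
    have e : ((N : ℝ) ^ (-(1/2 : ℝ))) ^ 2 = (N : ℝ)⁻¹ := by
      rw [← Real.rpow_natCast, ← Real.rpow_mul hNr.le]
      norm_num [Real.rpow_neg_one]
    rw [hA, mul_pow, mul_pow, Real.sq_sqrt (by positivity), Real.sq_sqrt hS0, e]
    field_simp
  have e3 : 6 * N * A ^ 2 / LineDisc.K = S / 2 := by
    rw [mul_assoc, hA2]; field_simp; ring
  rw [← hS, e3] at hfin
  have hSz : S = 0 := by linarith
  rw [hSz, Real.sqrt_zero, mul_zero] at hA
  exact hpos.ne' hA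
end

section
/- There exists an absolute constant C > 0 with the following property. Let N be a positive integer and let f : ℝ² → ℂ be zero outside [0,N] × [0,N] and constant, equal to z_{ij} ∈ {+1,−1}, on each unit square (i,j) + [0,1)², 0 ≤ i,j < N. Then there exists a straight line S such that |∫_S f| ≥ C √N, where ∫_S f is the integral of f along S with respect to arc-length measure. -/
open MeasureTheory Real

lemma gauss_int {s : ℝ} (hs : 0 < s) (x : ℂ) : ∫ w : ℂ, rexp (-s * ‖w - x‖ ^ 2) = π / s := by
  rw [integral_sub_right_eq_self (fun w : ℂ => rexp (-s * ‖w‖ ^ 2)) x,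
    GaussianFourier.integral_rexp_neg_mul_sq_norm hs]
  simp [Complex.finrank_real_complex]

lemma gauss_integrable {s : ℝ} (hs : 0 < s) (x : ℂ) :
    Integrable (fun w : ℂ => rexp (-s * ‖w - x‖ ^ 2)) := by
  apply Integrable.of_integral_ne_zero
  rw [gauss_int hs]
  positivity

lemma gauss_conv {s : ℝ} (hs : 0 < s) (x y : ℂ) :
    ∫ w : ℂ, rexp (-(2 * s) * ‖w - x‖ ^ 2) * rexp (-(2 * s) * ‖w - y‖ ^ 2)
      = rexp (-s * ‖x - y‖ ^ 2) * (π / (4 * s)) := by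
  rw [← gauss_int (s := 4 * s) (by positivity) ((x + y) / 2), ← integral_const_mul]
  congr 1
  ext w
  rw [← Real.exp_add, ← Real.exp_add]
  congr 1
  simp only [← Complex.normSq_eq_norm_sq, Complex.normSq_apply, Complex.sub_re, Complex.sub_im,
    Complex.div_ofNat_re, Complex.div_ofNat_im, Complex.add_re, Complex.add_im]
  ring

lemma psd_pos (μ : Measure ℂ) [IsFiniteMeasure μ] (g : ℂ → ℝ) (hg : Measurable g)
    (hb : ∀ x, |g x| ≤ 1) {s : ℝ} (hs : 0 < s) :
    0 ≤ ∫ p : ℂ × ℂ, g p.1 * g p.2 * rexp (-s * ‖p.1 - p.2‖ ^ 2) ∂(μ.prod μ) := by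
  have key : (∫ p : ℂ × ℂ, g p.1 * g p.2 * rexp (-s * ‖p.1 - p.2‖ ^ 2) ∂(μ.prod μ)) * (π / (4 * s))
      = ∫ w : ℂ, (∫ x, g x * rexp (-(2 * s) * ‖w - x‖ ^ 2) ∂μ) ^ 2 := by
    rw [← integral_mul_const]
    have h1 : ∀ p : ℂ × ℂ, g p.1 * g p.2 * rexp (-s * ‖p.1 - p.2‖ ^ 2) * (π / (4 * s))
        = ∫ w : ℂ, (g p.1 * rexp (-(2 * s) * ‖w - p.1‖ ^ 2)) *
            (g p.2 * rexp (-(2 * s) * ‖w - p.2‖ ^ 2)) := by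
      intro p
      rw [mul_assoc, ← gauss_conv hs, ← integral_const_mul]
      congr 1
      ext w
      ring
    simp_rw [h1]
    rw [integral_integral_swap]
    · congr 1
      ext w
      rw [integral_prod_mul (μ := μ) (ν := μ) (fun x => g x * rexp (-(2 * s) * ‖w - x‖ ^ 2))
        (fun x => g x * rexp (-(2 * s) * ‖w - x‖ ^ 2)), sq]
    · have hmaj : Integrable (fun q : (ℂ × ℂ) × ℂ => rexp (-(2 * s) * ‖q.2 - q.1.1‖ ^ 2))
          ((μ.prod μ).prod volume) := by
        have hc : Continuous (fun q : (ℂ × ℂ) × ℂ => rexp (-(2 * s) * ‖q.2 - q.1.1‖ ^ 2)) := by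
          fun_prop
        rw [integrable_prod_iff hc.aestronglyMeasurable]
        refine ⟨Filter.Eventually.of_forall fun p => gauss_integrable (s := 2 * s) (by positivity) p.1, ?_⟩
        simp only [Real.norm_eq_abs, abs_exp]
        simp_rw [gauss_int (s := 2 * s) (by positivity)]
        exact integrable_const _
      refine hmaj.mono' ?_ (Filter.Eventually.of_forall ?_)
      · apply Measurable.aestronglyMeasurable
        unfold Function.uncurry
        fun_prop
      · rintro ⟨⟨x, y⟩, w⟩
        simp only [Function.uncurry, norm_mul, Real.norm_eq_abs, abs_exp]
        have h3 : rexp (-(2 * s) * ‖w - y‖ ^ 2) ≤ 1 := by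
          apply Real.exp_le_one_iff.mpr
          have : 0 ≤ (2 * s) * ‖w - y‖ ^ 2 := by positivity
          linarith
        have h4 : |g x| * rexp (-(2 * s) * ‖w - x‖ ^ 2) ≤ rexp (-(2 * s) * ‖w - x‖ ^ 2) :=
          mul_le_of_le_one_left (exp_pos _).le (hb x)
        have h5 : |g y| * rexp (-(2 * s) * ‖w - y‖ ^ 2) ≤ 1 :=
          mul_le_one₀ (hb y) (exp_pos _).le h3
        calc _ ≤ rexp (-(2 * s) * ‖w - x‖ ^ 2) * 1 := by
              apply mul_le_mul h4 h5 (by positivity) (exp_pos _).le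
          _ = _ := mul_one _
  have h2 : 0 ≤ ∫ w : ℂ, (∫ x, g x * rexp (-(2 * s) * ‖w - x‖ ^ 2) ∂μ) ^ 2 :=
    integral_nonneg fun w => sq_nonneg _
  rw [← key] at h2
  exact nonneg_of_mul_nonneg_left h2 (by positivity)

lemma psd (μ : Measure ℂ) [IsFiniteMeasure μ] (g : ℂ → ℝ) (hg : Measurable g)
    (hb : ∀ x, |g x| ≤ 1) {s : ℝ} (hs : 0 ≤ s) :
    0 ≤ ∫ p : ℂ × ℂ, g p.1 * g p.2 * rexp (-s * ‖p.1 - p.2‖ ^ 2) ∂(μ.prod μ) := by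
  rcases hs.eq_or_lt with rfl | h
  · simp only [neg_zero, zero_mul, Real.exp_zero, mul_one]
    rw [integral_prod_mul]
    exact mul_self_nonneg _
  · exact psd_pos μ g hg hb h

lemma rot_avg (l : ℝ) (u : ℂ) :
    ∫ θ in (0:ℝ)..2 * π, rexp (-l * (u.re * cos θ + u.im * sin θ) ^ 2)
      = ∫ θ in (0:ℝ)..2 * π, rexp (-(l * cos θ ^ 2) * ‖u‖ ^ 2) := by
  have h : ∀ θ, rexp (-l * (u.re * cos θ + u.im * sin θ) ^ 2)
      = (fun t => rexp (-(l * cos t ^ 2) * ‖u‖ ^ 2)) (θ - u.arg) := by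
    intro θ
    simp only [cos_sub]
    congr 1
    rw [← Complex.norm_mul_cos_arg u, ← Complex.norm_mul_sin_arg u]
    ring
  simp_rw [h]
  rw [intervalIntegral.integral_comp_sub_right (fun t => rexp (-(l * cos t ^ 2) * ‖u‖ ^ 2))]
  have hp : Function.Periodic (fun t => rexp (-(l * cos t ^ 2) * ‖u‖ ^ 2)) (2 * π) := by
    intro t
    simp
  have := hp.intervalIntegral_add_eq (0 - u.arg) 0
  rw [zero_add] at this
  rw [← this]
  congr 1
  ring

lemma avg_swap (μ : Measure ℂ) [IsFiniteMeasure μ] (g : ℂ → ℝ) (hg : Measurable g)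
    (hb : ∀ x, |g x| ≤ 1) (K : ℝ → ℂ → ℝ) (hK : Measurable (Function.uncurry K))
    (hK1 : ∀ θ u, |K θ u| ≤ 1) :
    ∫ θ in (0:ℝ)..2 * π, (∫ p : ℂ × ℂ, g p.1 * g p.2 * K θ (p.1 - p.2) ∂(μ.prod μ))
      = ∫ p : ℂ × ℂ, g p.1 * g p.2 * (∫ θ in (0:ℝ)..2 * π, K θ (p.1 - p.2)) ∂(μ.prod μ) := by
  simp_rw [intervalIntegral.integral_of_le two_pi_pos.le]
  rw [integral_integral_swap]
  · simp_rw [integral_const_mul]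
  · refine Integrable.of_bound ?_ 1 (Filter.Eventually.of_forall ?_)
    · apply Measurable.aestronglyMeasurable
      have : Measurable fun q : ℝ × (ℂ × ℂ) => Function.uncurry K (q.1, q.2.1 - q.2.2) :=
        hK.comp (by fun_prop)
      unfold Function.uncurry at *
      fun_prop
    · rintro ⟨θ, x, y⟩
      simp only [Function.uncurry, norm_mul, Real.norm_eq_abs]
      exact mul_le_one₀ (mul_le_one₀ (hb _) (abs_nonneg _) (hb _)) (abs_nonneg _) (hK1 _ _)

lemma avg_eq (μ : Measure ℂ) [IsFiniteMeasure μ] (g : ℂ → ℝ) (hg : Measurable g)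
    (hb : ∀ x, |g x| ≤ 1) {l : ℝ} (hl : 0 ≤ l) :
    ∫ θ in (0:ℝ)..2 * π, (∫ p : ℂ × ℂ, g p.1 * g p.2 *
        rexp (-l * ((p.1 - p.2).re * cos θ + (p.1 - p.2).im * sin θ) ^ 2) ∂(μ.prod μ))
      = ∫ θ in (0:ℝ)..2 * π, (∫ p : ℂ × ℂ, g p.1 * g p.2 *
        rexp (-(l * cos θ ^ 2) * ‖p.1 - p.2‖ ^ 2) ∂(μ.prod μ)) := by
  rw [avg_swap μ g hg hb (fun θ u => rexp (-l * (u.re * cos θ + u.im * sin θ) ^ 2)),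
    avg_swap μ g hg hb (fun θ u => rexp (-(l * cos θ ^ 2) * ‖u‖ ^ 2))]
  · simp_rw [rot_avg]
  · unfold Function.uncurry
    fun_prop
  · intro θ u
    rw [abs_exp, Real.exp_le_one_iff]
    have : 0 ≤ (l * cos θ ^ 2) * ‖u‖ ^ 2 := by positivity
    linarith
  · unfold Function.uncurry
    fun_prop
  · intro θ u
    rw [abs_exp, Real.exp_le_one_iff]
    have : 0 ≤ l * (u.re * cos θ + u.im * sin θ) ^ 2 := by positivity
    linarith

/-- The half-open rectangle. -/
def rect (a b c d : ℝ) : Set ℂ := {x | a ≤ x.re ∧ x.re < b ∧ c ≤ x.im ∧ x.im < d}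

lemma rect_meas (a b c d : ℝ) : MeasurableSet (rect a b c d) := by
  unfold rect
  measurability

lemma rect_vol (a b c d : ℝ) :
    volume (rect a b c d) = ENNReal.ofReal (b - a) * ENNReal.ofReal (d - c) := by
  have h : rect a b c d = Complex.measurableEquivRealProd ⁻¹' (Set.Ico a b ×ˢ Set.Ico c d) := by
    ext x
    simp [rect, Complex.measurableEquivRealProd_apply, and_assoc]
  rw [h, Complex.volume_preserving_equiv_real_prod.measure_preimage
    (measurableSet_Ico.prod measurableSet_Ico).nullMeasurableSet, Measure.volume_eq_prod,
    Measure.prod_prod, Real.volume_Ico, Real.volume_Ico]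

lemma rect_real {a b c d : ℝ} (h1 : a ≤ b) (h2 : c ≤ d) :
    volume.real (rect a b c d) = (b - a) * (d - c) := by
  rw [measureReal_def, rect_vol, ENNReal.toReal_mul, ENNReal.toReal_ofReal (by linarith),
    ENNReal.toReal_ofReal (by linarith)]

instance rect_fin (a b c d : ℝ) : IsFiniteMeasure (volume.restrict (rect a b c d)) := by
  constructor
  rw [Measure.restrict_apply_univ, rect_vol]
  exact ENNReal.mul_lt_top ENNReal.ofReal_lt_top ENNReal.ofReal_lt_top

lemma gauss_ball {s : ℝ} (hs : 8000 ≤ s) (x : ℂ) :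
    π / s * (9 / 11) ≤ ∫ y in Metric.ball x (1 / 20), rexp (-s * ‖y - x‖ ^ 2) := by
  have hs0 : 0 < s := by linarith
  have h1 := integral_add_compl (μ := volume) (Metric.isOpen_ball (x := x) (ε := 1 / 20)).measurableSet
    (gauss_integrable hs0 x)
  rw [gauss_int hs0] at h1
  have h2 : ∫ y in (Metric.ball x (1 / 20))ᶜ, rexp (-s * ‖y - x‖ ^ 2)
      ≤ ∫ y in (Metric.ball x (1 / 20))ᶜ, (1 / 11) * rexp (-(s / 2) * ‖y - x‖ ^ 2) := by
    apply setIntegral_mono_on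
    · exact (gauss_integrable hs0 x).integrableOn
    · exact ((gauss_integrable (s := s / 2) (by positivity) x).const_mul _).integrableOn
    · exact (Metric.isOpen_ball).measurableSet.compl
    · intro y hy
      have hy' : 1 / 20 ≤ ‖y - x‖ := by
        simpa [dist_eq_norm] using hy
      have h3 : -s * ‖y - x‖ ^ 2 ≤ -10 + -(s / 2) * ‖y - x‖ ^ 2 := by
        have : (1 / 20) ^ 2 ≤ ‖y - x‖ ^ 2 := by gcongr
        nlinarith
      have h4 : rexp (-10) ≤ 1 / 11 := by
        have := Real.add_one_le_exp (10 : ℝ)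
        rw [Real.exp_neg, ← one_div]
        apply one_div_le_one_div_of_le <;> linarith
      calc rexp (-s * ‖y - x‖ ^ 2) ≤ rexp (-10 + -(s / 2) * ‖y - x‖ ^ 2) := Real.exp_le_exp.mpr h3
        _ = rexp (-10) * rexp (-(s / 2) * ‖y - x‖ ^ 2) := Real.exp_add _ _
        _ ≤ _ := by gcongr
  have h5 : ∫ y in (Metric.ball x (1 / 20))ᶜ, (1 / 11) * rexp (-(s / 2) * ‖y - x‖ ^ 2)
      ≤ ∫ y, (1 / 11) * rexp (-(s / 2) * ‖y - x‖ ^ 2) := by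
    apply setIntegral_le_integral
    · exact ((gauss_integrable (s := s / 2) (by positivity) x).const_mul _)
    · exact Filter.Eventually.of_forall fun y => by positivity
  replace h5 := h2.trans h5
  rw [integral_const_mul, gauss_int (by positivity)] at h5
  have h6 : π / (s / 2) = 2 * (π / s) := by field_simp
  rw [h6] at h5
  linarith

/-- data for a colouring -/
structure Good (N : ℕ) (g : ℂ → ℝ) : Prop where
  meas : Measurable g
  bd : ∀ x, |g x| ≤ 1
  supp : ∀ x, x ∉ rect 0 N 0 N → g x = 0
  cell : ∀ i < N, ∀ j < N, ∀ x ∈ rect i (i + 1) j (j + 1), ∀ y ∈ rect i (i + 1) j (j + 1),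
    g x * g y = 1

lemma cell_sub {N i j : ℕ} (hi : i < N) (hj : j < N) :
    rect i (i + 1) j (j + 1) ⊆ rect 0 N 0 N := by
  rintro x ⟨h1, h2, h3, h4⟩
  have hi' : (i : ℝ) + 1 ≤ N := by exact_mod_cast hi
  have hj' : (j : ℝ) + 1 ≤ N := by exact_mod_cast hj
  have : (0 : ℝ) ≤ i := by positivity
  have : (0 : ℝ) ≤ j := by positivity
  refine ⟨?_, ?_, ?_, ?_⟩ <;> linarith

lemma F_lower {N : ℕ} {g : ℂ → ℝ} (hg : Good N g) {s : ℝ} (hs : 0 < s) (x : ℂ) :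
    -(π / s) ≤ ∫ y in rect 0 N 0 N, g x * g y * rexp (-s * ‖x - y‖ ^ 2) := by
  have h1 : ∫ y in rect 0 N 0 N, -rexp (-s * ‖y - x‖ ^ 2)
      ≤ ∫ y in rect 0 N 0 N, g x * g y * rexp (-s * ‖x - y‖ ^ 2) := by
    apply integral_mono
    · exact (gauss_integrable hs x).integrableOn.neg
    · have hm := hg.meas
      refine Integrable.mono' (gauss_integrable hs x).integrableOn
        (Measurable.aestronglyMeasurable (by fun_prop)) (Filter.Eventually.of_forall fun y => ?_)
      rw [norm_sub_rev y x]
      simp only [norm_mul, Real.norm_eq_abs, abs_exp]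
      apply mul_le_of_le_one_left (exp_pos _).le
      exact mul_le_one₀ (hg.bd _) (abs_nonneg _) (hg.bd _)
    · intro y
      simp only
      rw [norm_sub_rev y x]
      have h2 : |g x * g y| ≤ 1 := by
        rw [abs_mul]
        exact mul_le_one₀ (hg.bd _) (abs_nonneg _) (hg.bd _)
      have h3 := (abs_le.mp h2).1
      nlinarith [exp_pos (-s * ‖x - y‖ ^ 2)]
  rw [integral_neg] at h1
  have h5 : ∫ y in rect 0 N 0 N, rexp (-s * ‖y - x‖ ^ 2) ≤ ∫ y, rexp (-s * ‖y - x‖ ^ 2) := by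
    apply setIntegral_le_integral (gauss_integrable hs x)
    exact Filter.Eventually.of_forall fun y => by positivity
  rw [gauss_int hs] at h5
  linarith

lemma F_inner {N : ℕ} {g : ℂ → ℝ} (hg : Good N g) {s : ℝ} (hs : 8000 ≤ s) {i j : ℕ}
    (hi : i < N) (hj : j < N) (x : ℂ)
    (hx : x ∈ rect (i + 1 / 20) (i + 1 - 1 / 20) (j + 1 / 20) (j + 1 - 1 / 20)) :
    π / s * (7 / 11) ≤ ∫ y in rect 0 N 0 N, g x * g y * rexp (-s * ‖x - y‖ ^ 2) := by
  have hs0 : 0 < s := by linarith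
  have hball : Metric.ball x (1 / 20) ⊆ rect i (i + 1) j (j + 1) := by
    intro y hy
    rw [Metric.mem_ball, dist_eq_norm] at hy
    have h1 := abs_lt.mp ((Complex.abs_re_le_norm (y - x)).trans_lt hy)
    have h2 := abs_lt.mp ((Complex.abs_im_le_norm (y - x)).trans_lt hy)
    rw [Complex.sub_re] at h1
    rw [Complex.sub_im] at h2
    obtain ⟨h3, h4, h5, h6⟩ := hx
    refine ⟨?_, ?_, ?_, ?_⟩ <;> linarith
  have hxc : x ∈ rect i (i + 1) j (j + 1) := hball (by simp)
  have hg1 : ∀ y, |g x * g y| ≤ 1 := by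
    intro y
    rw [abs_mul]
    exact mul_le_one₀ (hg.bd _) (abs_nonneg _) (hg.bd _)
  have hi1 : Integrable (fun y => g x * g y * rexp (-s * ‖y - x‖ ^ 2)) := by
    have hm := hg.meas
    refine Integrable.mono' (gauss_integrable hs0 x)
      (Measurable.aestronglyMeasurable (by fun_prop)) (Filter.Eventually.of_forall fun y => ?_)
    rw [norm_mul, Real.norm_eq_abs, Real.norm_eq_abs, abs_exp]
    exact mul_le_of_le_one_left (exp_pos _).le (hg1 y)
  have hi2 := gauss_integrable hs0 x
  have h1 : ∫ y in Metric.ball x (1 / 20), 2 * rexp (-s * ‖y - x‖ ^ 2)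
      ≤ ∫ y in rect 0 N 0 N, (g x * g y * rexp (-s * ‖y - x‖ ^ 2) + rexp (-s * ‖y - x‖ ^ 2)) := by
    calc _ = ∫ y in Metric.ball x (1 / 20),
          (g x * g y * rexp (-s * ‖y - x‖ ^ 2) + rexp (-s * ‖y - x‖ ^ 2)) := by
          apply setIntegral_congr_fun Metric.isOpen_ball.measurableSet
          intro y hy
          simp only
          rw [hg.cell i hi j hj x hxc y (hball hy)]
          ring
      _ ≤ _ := by
          apply setIntegral_mono_set (hi1.add hi2).integrableOn
          · refine Filter.Eventually.of_forall fun y => ?_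
            have h3 := (abs_le.mp (hg1 y)).1
            simp only [Pi.zero_apply, Pi.add_apply]
            nlinarith [exp_pos (-s * ‖y - x‖ ^ 2)]
          · exact (hball.trans (cell_sub hi hj)).eventuallyLE
  rw [integral_const_mul, integral_add hi1.integrableOn hi2.integrableOn] at h1
  have h5 : ∫ y in rect 0 N 0 N, rexp (-s * ‖y - x‖ ^ 2) ≤ ∫ y, rexp (-s * ‖y - x‖ ^ 2) := by
    apply setIntegral_le_integral (gauss_integrable hs0 x)
    exact Filter.Eventually.of_forall fun y => by positivity
  rw [gauss_int hs0] at h5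
  have h6 := gauss_ball hs x
  simp_rw [norm_sub_rev x]
  linarith

lemma rect_union (N : ℕ) : rect 0 N 0 N =
    ⋃ q ∈ Finset.range N ×ˢ Finset.range N, rect (q.1 : ℕ) ((q.1 : ℕ) + 1) (q.2 : ℕ) ((q.2 : ℕ) + 1) := by
  apply Set.Subset.antisymm
  · rintro x ⟨h1, h2, h3, h4⟩
    simp only [Set.mem_iUnion]
    refine ⟨(⌊x.re⌋₊, ⌊x.im⌋₊), ?_, Nat.floor_le h1, Nat.lt_floor_add_one _, Nat.floor_le h3,
      Nat.lt_floor_add_one _⟩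
    simp [Nat.floor_lt h1, Nat.floor_lt h3, h2, h4]
  · simp only [Set.iUnion_subset_iff]
    intro q hq
    simp only [Finset.mem_product, Finset.mem_range] at hq
    exact cell_sub hq.1 hq.2

lemma mem_cell_floor {i j : ℕ} {x : ℂ} (h : x ∈ rect i (i + 1) j (j + 1)) :
    ⌊x.re⌋₊ = i ∧ ⌊x.im⌋₊ = j := by
  obtain ⟨h1, h2, h3, h4⟩ := h
  have h0 : (0 : ℝ) ≤ i := by positivity
  have h0' : (0 : ℝ) ≤ j := by positivity
  exact ⟨(Nat.floor_eq_iff (by linarith)).mpr ⟨h1, h2⟩, (Nat.floor_eq_iff (by linarith)).mpr ⟨h3, h4⟩⟩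

lemma lower_s2 {N : ℕ} {g : ℂ → ℝ} (hg : Good N g) {s : ℝ} (hs : 8000 ≤ s) :
    π / s * (1 / 5) * N ^ 2 ≤ ∫ p : ℂ × ℂ, g p.1 * g p.2 * rexp (-s * ‖p.1 - p.2‖ ^ 2)
      ∂((volume.restrict (rect 0 N 0 N)).prod (volume.restrict (rect 0 N 0 N))) := by
  have hs0 : 0 < s := by linarith
  have hm := hg.meas
  have hint : Integrable (fun p : ℂ × ℂ => g p.1 * g p.2 * rexp (-s * ‖p.1 - p.2‖ ^ 2))
      ((volume.restrict (rect 0 N 0 N)).prod (volume.restrict (rect 0 N 0 N))) := by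
    refine Integrable.of_bound (Measurable.aestronglyMeasurable (by fun_prop)) 1
      (Filter.Eventually.of_forall fun p => ?_)
    simp only [norm_mul, Real.norm_eq_abs, abs_exp]
    refine mul_le_one₀ (mul_le_one₀ (hg.bd _) (abs_nonneg _) (hg.bd _)) (exp_pos _).le ?_
    rw [Real.exp_le_one_iff]
    have : 0 ≤ s * ‖p.1 - p.2‖ ^ 2 := by positivity
    linarith
  rw [integral_prod _ hint]
  have hF := hint.integral_prod_left
  simp only at hF ⊢
  set F : ℂ → ℝ := fun x => ∫ y in rect 0 N 0 N, g x * g y * rexp (-s * ‖x - y‖ ^ 2) with hFdef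
  change π / s * (1 / 5) * N ^ 2 ≤ ∫ x in rect 0 N 0 N, F x
  have hFon : IntegrableOn F (rect 0 N 0 N) := hF
  have hcell : ∀ q ∈ Finset.range N ×ˢ Finset.range N,
      π / s * (1 / 5) ≤ ∫ x in rect (q.1 : ℕ) ((q.1 : ℕ) + 1) (q.2 : ℕ) ((q.2 : ℕ) + 1), F x := by
    rintro ⟨i, j⟩ hq
    simp only [Finset.mem_product, Finset.mem_range] at hq
    obtain ⟨hi, hj⟩ := hq
    simp only
    set R := rect (i + 1 / 20) (i + 1 - 1 / 20) (j + 1 / 20) (j + 1 - 1 / 20) with hR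
    have hRm : MeasurableSet R := rect_meas _ _ _ _
    have hsub : R ⊆ rect i (i + 1) j (j + 1) := by
      rintro x ⟨h3, h4, h5, h6⟩
      refine ⟨?_, ?_, ?_, ?_⟩ <;> linarith
    have hRr : volume.real R = 81 / 100 := by
      rw [hR, rect_real (by linarith) (by linarith)]
      ring
    have hCr : volume.real (rect i (i + 1) j (j + 1)) = 1 := by
      rw [rect_real (by linarith) (by linarith)]
      ring
    have hi1 : Integrable (R.indicator fun _ => π / s * (18 / 11))
        (volume.restrict (rect i (i + 1) j (j + 1))) := (integrable_const _).indicator hRm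
    have h1 : ∫ x in rect i (i + 1) j (j + 1),
        (R.indicator (fun _ => π / s * (18 / 11)) x - π / s)
        ≤ ∫ x in rect i (i + 1) j (j + 1), F x := by
      apply setIntegral_mono_on
      · exact hi1.sub (integrable_const _)
      · exact hFon.mono_set (cell_sub hi hj)
      · exact rect_meas _ _ _ _
      · intro x _
        by_cases hx : x ∈ R
        · rw [Set.indicator_of_mem hx]
          have := F_inner hg hs hi hj x hx
          linarith
        · rw [Set.indicator_of_notMem hx]
          have := F_lower hg hs0 x
          linarith
    rw [integral_sub hi1 (integrable_const _), setIntegral_indicator hRm,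
      Set.inter_eq_right.mpr hsub] at h1
    simp only [integral_const, measureReal_restrict_apply_univ, hRr, hCr, smul_eq_mul] at h1
    have : 0 < π / s := by positivity
    linarith
  rw [rect_union, integral_biUnion_finset]
  · calc π / s * (1 / 5) * N ^ 2 = ∑ q ∈ Finset.range N ×ˢ Finset.range N, π / s * (1 / 5) := by
          simp
          ring
      _ ≤ _ := Finset.sum_le_sum hcell
  · intro q _
    exact rect_meas _ _ _ _
  · intro q _ q' _ hne
    refine Set.disjoint_left.mpr fun x hx hx' => hne ?_
    have h1 := mem_cell_floor hx
    have h2 := mem_cell_floor hx'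
    exact Prod.ext (h1.1.symm.trans h2.1) (h1.2.symm.trans h2.2)
  · intro q hq
    simp only [Finset.mem_product, Finset.mem_range] at hq
    exact hFon.mono_set (cell_sub hq.1 hq.2)

/-- Point with rotated coordinates `(t, r)`. -/
noncomputable def rpt (θ t r : ℝ) : ℂ := ⟨t * cos θ - r * sin θ, t * sin θ + r * cos θ⟩

/-- The projection of `g` in direction `θ`. -/
noncomputable def proj (g : ℂ → ℝ) (θ t : ℝ) : ℝ := ∫ r : ℝ, g (rpt θ t r)

lemma rpt_meas (θ : ℝ) : Measurable fun q : ℝ × ℝ => rpt θ q.1 q.2 := by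
  have h : (fun q : ℝ × ℝ => rpt θ q.1 q.2) = fun q : ℝ × ℝ =>
      Complex.measurableEquivRealProd.symm
        (q.1 * cos θ - q.2 * sin θ, q.1 * sin θ + q.2 * cos θ) := rfl
  rw [h]
  exact Complex.measurableEquivRealProd.symm.measurable.comp (by fun_prop)

lemma rpt_coord (θ t r : ℝ) :
    (rpt θ t r).re * cos θ + (rpt θ t r).im * sin θ = t := by
  simp only [rpt]
  linear_combination t * (Real.sin_sq_add_cos_sq θ)

lemma rpt_preserving (θ : ℝ) :
    MeasurePreserving (fun q : ℝ × ℝ => rpt θ q.1 q.2) volume volume := by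
  have h := (rotation (Circle.exp θ)).measurePreserving.comp
    Complex.volume_preserving_equiv_real_prod.symm
  have heq : (fun q : ℝ × ℝ => rpt θ q.1 q.2)
      = ⇑(rotation (Circle.exp θ)) ∘ ⇑Complex.measurableEquivRealProd.symm := by
    funext q
    apply Complex.ext
    · simp [rpt, Complex.measurableEquivRealProd_symm_apply, Complex.exp_ofReal_mul_I_re,
        Complex.exp_ofReal_mul_I_im]
      ring
    · simp [rpt, Complex.measurableEquivRealProd_symm_apply, Complex.exp_ofReal_mul_I_re,
        Complex.exp_ofReal_mul_I_im]
      ring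
  rw [heq]
  exact h

lemma rpt_integral (θ : ℝ) (h : ℂ → ℝ) (hm : Measurable h) :
    ∫ x, h x = ∫ q : ℝ × ℝ, h (rpt θ q.1 q.2) := by
  have hp := rpt_preserving θ
  conv_lhs => rw [← hp.map_eq]
  rw [integral_map hp.measurable.aemeasurable hm.aestronglyMeasurable]

lemma slice {N : ℕ} {g : ℂ → ℝ} (hg : Good N g) (θ : ℝ) (φ : ℝ → ℝ) (hφ : Measurable φ)
    {B : ℝ} (hB : ∀ t, |φ t| ≤ B) :
    ∫ x in rect 0 N 0 N, g x * φ (x.re * cos θ + x.im * sin θ) = ∫ t, φ t * proj g θ t := by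
  have hm := hg.meas
  have hhm : Measurable fun x : ℂ => g x * φ (x.re * cos θ + x.im * sin θ) := by fun_prop
  have hon : IntegrableOn (fun x : ℂ => g x * φ (x.re * cos θ + x.im * sin θ)) (rect 0 N 0 N) := by
    refine Integrable.of_bound hhm.aestronglyMeasurable B (Filter.Eventually.of_forall fun x => ?_)
    rw [norm_mul, Real.norm_eq_abs, Real.norm_eq_abs]
    calc _ ≤ 1 * B := mul_le_mul (hg.bd _) (hB _) (abs_nonneg _) zero_le_one
      _ = B := one_mul _
  have hz : ∀ x, x ∉ rect 0 N 0 N → g x * φ (x.re * cos θ + x.im * sin θ) = 0 := by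
    intro x hx
    rw [hg.supp x hx, zero_mul]
  have hall : Integrable (fun x : ℂ => g x * φ (x.re * cos θ + x.im * sin θ)) :=
    (integrableOn_iff_integrable_of_support_subset (by
      intro x hx
      by_contra hc
      exact hx (hz x hc))).mp hon
  rw [setIntegral_eq_integral_of_forall_compl_eq_zero hz, rpt_integral θ _ hhm]
  have h2 := (rpt_preserving θ).integrable_comp_of_integrable hall
  rw [Measure.volume_eq_prod] at h2 ⊢
  simp only [rpt_coord]
  simp only [Function.comp_def, rpt_coord] at h2
  rw [integral_prod _ h2]
  congr 1
  ext t
  simp only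
  rw [integral_mul_const, mul_comm]
  rfl

lemma proj_zero {N : ℕ} {g : ℂ → ℝ} (hg : Good N g) (θ t : ℝ) (ht : 2 * (N : ℝ) < |t|) :
    proj g θ t = 0 := by
  unfold proj
  have : ∀ r, g (rpt θ t r) = 0 := by
    intro r
    apply hg.supp
    intro hx
    have h := rpt_coord θ t r
    generalize rpt θ t r = x at *
    obtain ⟨h1, h2, h3, h4⟩ := hx
    have h5 : |x.re * cos θ| ≤ N := by
      rw [abs_mul, abs_of_nonneg h1]
      calc _ ≤ x.re * 1 := by gcongr; exact abs_cos_le_one θ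
        _ ≤ N := by linarith
    have h6 : |x.im * sin θ| ≤ N := by
      rw [abs_mul, abs_of_nonneg h3]
      calc _ ≤ x.im * 1 := by gcongr; exact abs_sin_le_one θ
        _ ≤ N := by linarith
    have h7 := abs_add_le (x.re * cos θ) (x.im * sin θ)
    rw [h] at h7
    linarith
  simp [this]

lemma gauss1_int {l : ℝ} (x : ℝ) : ∫ w : ℝ, rexp (-l * (w - x) ^ 2) = √(π / l) := by
  rw [integral_sub_right_eq_self (fun w : ℝ => rexp (-l * w ^ 2)) x, integral_gaussian]

lemma gauss1_integrable {l : ℝ} (hl : 0 < l) (x : ℝ) :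
    Integrable (fun w : ℝ => rexp (-l * (w - x) ^ 2)) :=
  (integrable_exp_neg_mul_sq hl).comp_sub_right x

lemma upper {N : ℕ} {g : ℂ → ℝ} (hg : Good N g) {l M : ℝ} (hl : 0 < l) (hM : 0 ≤ M) (θ : ℝ)
    (hP : ∀ t, |proj g θ t| ≤ M) :
    ∫ p : ℂ × ℂ, g p.1 * g p.2 *
        rexp (-l * ((p.1 - p.2).re * cos θ + (p.1 - p.2).im * sin θ) ^ 2)
      ∂((volume.restrict (rect 0 N 0 N)).prod (volume.restrict (rect 0 N 0 N)))
      ≤ 4 * N * M ^ 2 * √(π / l) := by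
  have hm := hg.meas
  have hint : Integrable (fun p : ℂ × ℂ => g p.1 * g p.2 *
        rexp (-l * ((p.1 - p.2).re * cos θ + (p.1 - p.2).im * sin θ) ^ 2))
      ((volume.restrict (rect 0 N 0 N)).prod (volume.restrict (rect 0 N 0 N))) := by
    refine Integrable.of_bound (Measurable.aestronglyMeasurable (by fun_prop)) 1
      (Filter.Eventually.of_forall fun p => ?_)
    simp only [norm_mul, Real.norm_eq_abs, abs_exp]
    refine mul_le_one₀ (mul_le_one₀ (hg.bd _) (abs_nonneg _) (hg.bd _)) (exp_pos _).le ?_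
    rw [Real.exp_le_one_iff]
    have : 0 ≤ l * ((p.1 - p.2).re * cos θ + (p.1 - p.2).im * sin θ) ^ 2 := by positivity
    linarith
  rw [integral_prod _ hint]
  let H : ℝ → ℝ := fun τ => ∫ t, rexp (-l * (t - τ) ^ 2) * proj g θ t
  have hpm : StronglyMeasurable (proj g θ) := by
    apply StronglyMeasurable.integral_prod_right
    exact (hm.comp (rpt_meas θ)).stronglyMeasurable
  have hHm : Measurable H := by
    apply StronglyMeasurable.measurable
    apply StronglyMeasurable.integral_prod_right
    apply Measurable.stronglyMeasurable
    have := hpm.measurable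
    unfold Function.uncurry
    fun_prop
  have hHb : ∀ τ, |H τ| ≤ √(π / l) * M := by
    intro τ
    rw [← gauss1_int τ, ← integral_mul_const, ← Real.norm_eq_abs]
    apply norm_integral_le_of_norm_le ((gauss1_integrable hl τ).mul_const M)
    refine Filter.Eventually.of_forall fun t => ?_
    rw [norm_mul, Real.norm_eq_abs, Real.norm_eq_abs, abs_exp]
    gcongr
    exact hP t
  have hinner : ∀ x : ℂ, ∫ y in rect 0 N 0 N, g x * g y *
      rexp (-l * ((x - y).re * cos θ + (x - y).im * sin θ) ^ 2)
      = g x * H (x.re * cos θ + x.im * sin θ) := by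
    intro x
    have h := slice hg θ (fun t => rexp (-l * (t - (x.re * cos θ + x.im * sin θ)) ^ 2))
      (by fun_prop) (B := 1) (by
        intro t
        rw [abs_exp, Real.exp_le_one_iff]
        have : 0 ≤ l * (t - (x.re * cos θ + x.im * sin θ)) ^ 2 := by positivity
        linarith)
    simp only [H]
    rw [← h, ← integral_const_mul]
    congr 1
    ext y
    rw [mul_assoc, Complex.sub_re, Complex.sub_im]
    congr 4
    ring
  simp only [hinner]
  rw [slice hg θ H hHm hHb]
  have hsup : ∀ t, t ∉ Set.Icc (-(2 * (N : ℝ))) (2 * N) → H t * proj g θ t = 0 := by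
    intro t ht
    rw [proj_zero hg, mul_zero]
    by_contra hc
    exact ht (abs_le.mp (not_lt.mp hc))
  rw [← setIntegral_eq_integral_of_forall_compl_eq_zero hsup]
  refine (le_abs_self _).trans ?_
  rw [← Real.norm_eq_abs]
  refine (norm_setIntegral_le_of_norm_le_const (C := √(π / l) * M * M) ?_ ?_).trans ?_
  · exact measure_Icc_lt_top
  · intro t _
    rw [norm_mul, Real.norm_eq_abs, Real.norm_eq_abs]
    exact mul_le_mul (hHb t) (hP t) (abs_nonneg _) (by positivity)
  · rw [Real.volume_real_Icc_of_le (by have : (0 : ℝ) ≤ N := by positivity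
                                       linarith)]
    apply le_of_eq
    ring

lemma main_bound {N : ℕ} {g : ℂ → ℝ} (hN : 0 < N) (hg : Good N g) {M : ℝ} (hM : 0 ≤ M)
    (hP : ∀ θ, sin θ ≠ 0 → cos θ ≠ 0 → ∀ t, |proj g θ t| ≤ M) :
    N / 1000000000 ≤ M ^ 2 := by
  have hpi := Real.pi_gt_three
  have hpi4 := Real.pi_lt_four
  have hNr : (0 : ℝ) < N := by exact_mod_cast hN
  have heq := avg_eq (volume.restrict (rect 0 N 0 N)) g hg.meas hg.bd (l := 16000) (by norm_num)
  have hmK : ∀ K : ℝ → ℂ → ℝ, Measurable (Function.uncurry K) → (∀ θ u, |K θ u| ≤ 1) →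
      IntervalIntegrable (fun θ => ∫ p : ℂ × ℂ, g p.1 * g p.2 * K θ (p.1 - p.2)
        ∂((volume.restrict (rect 0 N 0 N)).prod (volume.restrict (rect 0 N 0 N))))
        volume 0 (2 * π) := by
    intro K hK hK1
    have hm := hg.meas
    have : Measurable fun q : ℝ × (ℂ × ℂ) => Function.uncurry K (q.1, q.2.1 - q.2.2) :=
      hK.comp (by fun_prop)
    rw [intervalIntegrable_iff_integrableOn_Ioc_of_le two_pi_pos.le]
    have hint : Integrable (fun q : ℝ × (ℂ × ℂ) => g q.2.1 * g q.2.2 * K q.1 (q.2.1 - q.2.2))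
        ((volume.restrict (Set.Ioc 0 (2 * π))).prod
          ((volume.restrict (rect 0 N 0 N)).prod (volume.restrict (rect 0 N 0 N)))) := by
      refine Integrable.of_bound ?_ 1 (Filter.Eventually.of_forall ?_)
      · apply Measurable.aestronglyMeasurable
        unfold Function.uncurry at this
        fun_prop
      · rintro ⟨θ, x, y⟩
        simp only [norm_mul, Real.norm_eq_abs]
        exact mul_le_one₀ (mul_le_one₀ (hg.bd _) (abs_nonneg _) (hg.bd _)) (abs_nonneg _) (hK1 _ _)
    exact hint.integral_prod_left
  have hI1 := hmK (fun θ u => rexp (-16000 * (u.re * cos θ + u.im * sin θ) ^ 2))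
    (by unfold Function.uncurry; fun_prop) (by
      intro θ u
      rw [abs_exp, Real.exp_le_one_iff]
      have : 0 ≤ (u.re * cos θ + u.im * sin θ) ^ 2 := by positivity
      linarith)
  have hI2 := hmK (fun θ u => rexp (-(16000 * cos θ ^ 2) * ‖u‖ ^ 2))
    (by unfold Function.uncurry; fun_prop) (by
      intro θ u
      rw [abs_exp, Real.exp_le_one_iff]
      have : 0 ≤ (16000 * cos θ ^ 2) * ‖u‖ ^ 2 := by positivity
      linarith)
  -- upper bound
  have hup : ∫ θ in (0:ℝ)..2 * π, (∫ p : ℂ × ℂ, g p.1 * g p.2 *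
        rexp (-16000 * ((p.1 - p.2).re * cos θ + (p.1 - p.2).im * sin θ) ^ 2)
        ∂((volume.restrict (rect 0 N 0 N)).prod (volume.restrict (rect 0 N 0 N))))
      ≤ ∫ θ in (0:ℝ)..2 * π, 4 * N * M ^ 2 * √(π / 16000) := by
    have hae1 : ∀ᵐ θ : ℝ, sin θ ≠ 0 := by
      have hc : ({θ : ℝ | sin θ = 0}).Countable := by
        have : {θ : ℝ | sin θ = 0} = Set.range fun n : ℤ => (n : ℝ) * π := by
          ext θ
          simp [Real.sin_eq_zero_iff]
        rw [this]
        exact Set.countable_range _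
      exact hc.ae_notMem volume
    have hae2 : ∀ᵐ θ : ℝ, cos θ ≠ 0 := by
      have hc : ({θ : ℝ | cos θ = 0}).Countable := by
        have : {θ : ℝ | cos θ = 0} = Set.range fun n : ℤ => (2 * (n : ℝ) + 1) * π / 2 := by
          ext θ
          rw [Set.mem_ofPred_eq, Real.cos_eq_zero_iff]
          simp [eq_comm]
        rw [this]
        exact Set.countable_range _
      exact hc.ae_notMem volume
    apply intervalIntegral.integral_mono_ae two_pi_pos.le hI1 (by simp)
    filter_upwards [hae1, hae2] with θ h1 h2
    exact upper hg (by norm_num) hM θ (hP θ h1 h2)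
  -- lower bound
  have hlow : ∫ θ in (0:ℝ)..(π / 4), π / 16000 * (1 / 5) * (N : ℝ) ^ 2
      ≤ ∫ θ in (0:ℝ)..2 * π, (∫ p : ℂ × ℂ, g p.1 * g p.2 *
        rexp (-(16000 * cos θ ^ 2) * ‖p.1 - p.2‖ ^ 2)
        ∂((volume.restrict (rect 0 N 0 N)).prod (volume.restrict (rect 0 N 0 N)))) := by
    have hI3 := hI2.mono_set (c := 0) (d := π / 4) (by
      rw [Set.uIcc_of_le (by positivity), Set.uIcc_of_le (by positivity)]
      exact Set.Icc_subset_Icc le_rfl (by linarith))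
    refine (intervalIntegral.integral_mono_on (by positivity) (by simp) hI3 ?_).trans
      (intervalIntegral.integral_mono_interval le_rfl (by positivity) (by linarith) ?_ hI2)
    · intro θ hθ
      have hcos : √2 / 2 ≤ cos θ := by
        rw [← Real.cos_pi_div_four]
        exact Real.cos_le_cos_of_nonneg_of_le_pi hθ.1 (by linarith) hθ.2
      have hsq : 1 / 2 ≤ cos θ ^ 2 := by
        have h1 : (√2 / 2) ^ 2 = 1 / 2 := by
          rw [div_pow, Real.sq_sqrt (by norm_num)]
          norm_num
        rw [← h1]
        gcongr
      have hle : cos θ ^ 2 ≤ 1 := Real.cos_sq_le_one θ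
      refine le_trans ?_ (lower_s2 hg (s := 16000 * cos θ ^ 2) (by linarith))
      gcongr
      linarith
    · exact Filter.Eventually.of_forall fun θ => psd _ g hg.meas hg.bd (by positivity)
  rw [← heq] at hlow
  have hfin := hlow.trans hup
  simp only [intervalIntegral.integral_const, smul_eq_mul, sub_zero] at hfin
  have hsqrt : √(π / 16000) ≤ 1 := by
    apply Real.sqrt_le_one.mpr
    linarith
  have h1 : 2 * π * (4 * N * M ^ 2 * √(π / 16000)) ≤ 2 * π * (4 * N * M ^ 2 * 1) := by gcongr
  have h2 := hfin.trans h1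
  have h3 : (π * N) * (N * (π / 320000)) ≤ (π * N) * (8 * M ^ 2) := by linarith
  have h4 := le_of_mul_le_mul_left h3 (by positivity)
  nlinarith

/-- Extension of the colouring to all pairs of natural numbers. -/
noncomputable def colExt {N : ℕ} (z : Fin N → Fin N → ℂ) (i j : ℕ) : ℝ :=
  if h : i < N ∧ j < N then (z ⟨i, h.1⟩ ⟨j, h.2⟩).re else 0

open Classical in
/-- The real step function. -/
noncomputable def stepFn {N : ℕ} (z : Fin N → Fin N → ℂ) (x : ℂ) : ℝ :=
  if x ∈ rect 0 N 0 N then colExt z ⌊x.re⌋₊ ⌊x.im⌋₊ else 0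

lemma colExt_of {N : ℕ} (z : Fin N → Fin N → ℂ) (hz : ∀ i j, z i j = 1 ∨ z i j = -1)
    {i j : ℕ} (hi : i < N) (hj : j < N) : ((colExt z i j : ℝ) : ℂ) = z ⟨i, hi⟩ ⟨j, hj⟩ := by
  unfold colExt
  rw [dif_pos ⟨hi, hj⟩]
  rcases hz ⟨i, hi⟩ ⟨j, hj⟩ with h | h <;> rw [h] <;> simp

lemma colExt_pm {N : ℕ} (z : Fin N → Fin N → ℂ) (hz : ∀ i j, z i j = 1 ∨ z i j = -1)
    {i j : ℕ} (hi : i < N) (hj : j < N) : colExt z i j = 1 ∨ colExt z i j = -1 := by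
  unfold colExt
  rw [dif_pos ⟨hi, hj⟩]
  rcases hz ⟨i, hi⟩ ⟨j, hj⟩ with h | h <;> rw [h] <;> simp

lemma colExt_abs {N : ℕ} (z : Fin N → Fin N → ℂ) (hz : ∀ i j, z i j = 1 ∨ z i j = -1)
    (i j : ℕ) : |colExt z i j| ≤ 1 := by
  by_cases h : i < N ∧ j < N
  · rcases colExt_pm z hz h.1 h.2 with h | h <;> rw [h] <;> simp
  · simp [colExt, h]

lemma stepFn_good {N : ℕ} (z : Fin N → Fin N → ℂ) (hz : ∀ i j, z i j = 1 ∨ z i j = -1) :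
    Good N (stepFn z) where
  meas := by
    unfold stepFn
    refine Measurable.ite (rect_meas _ _ _ _) ?_ measurable_const
    have h1 : Measurable (Function.uncurry (colExt z)) := measurable_of_countable _
    have h2 : Measurable fun x : ℂ => (⌊x.re⌋₊, ⌊x.im⌋₊) := by fun_prop
    exact h1.comp h2
  bd := by
    intro x
    unfold stepFn
    split_ifs
    · exact colExt_abs z hz _ _
    · simp
  supp := by
    intro x hx
    simp [stepFn, hx]
  cell := by
    intro i hi j hj x hx y hy
    unfold stepFn
    rw [if_pos (cell_sub hi hj hx), if_pos (cell_sub hi hj hy), (mem_cell_floor hx).1,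
      (mem_cell_floor hx).2, (mem_cell_floor hy).1, (mem_cell_floor hy).2]
    rcases colExt_pm z hz hi hj with h | h <;> rw [h] <;> norm_num


/-- For any `±1` coloring of the `N × N` checkerboard there is a straight line `S`
with `|∫_S f| ≥ C √N`. -/
theorem line_discrepancy_pm_one :
    ∃ C : ℝ, 0 < C ∧
      ∀ (N : ℕ), 0 < N →
        ∀ (z : Fin N → Fin N → ℂ) (f : EuclideanSpace ℝ (Fin 2) → ℂ),
          (∀ i j : Fin N, z i j = 1 ∨ z i j = -1) →
          (∀ x : EuclideanSpace ℝ (Fin 2),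
            ¬ (0 ≤ x 0 ∧ x 0 ≤ N ∧ 0 ≤ x 1 ∧ x 1 ≤ N) → f x = 0) →
          (∀ (i j : Fin N) (x : EuclideanSpace ℝ (Fin 2)),
            (i : ℝ) ≤ x 0 → x 0 < i + 1 → (j : ℝ) ≤ x 1 → x 1 < j + 1 → f x = z i j) →
          ∃ p v : EuclideanSpace ℝ (Fin 2), ‖v‖ = 1 ∧
            C * Real.sqrt N ≤ ‖lineIntegral f p v‖ := by
  refine ⟨1 / 100000, by norm_num, ?_⟩
  intro N hN z f hz hf0 hf1
  by_contra! hcon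
  have hfg : ∀ x : ℂ, x.re ≠ N → x.im ≠ N → f !₂[x.re, x.im] = ((stepFn z x : ℝ) : ℂ) := by
    intro x h1 h2
    by_cases hx : x ∈ rect 0 N 0 N
    · obtain ⟨a, b, c, d⟩ := hx
      have hi : ⌊x.re⌋₊ < N := (Nat.floor_lt a).mpr b
      have hj : ⌊x.im⌋₊ < N := (Nat.floor_lt c).mpr d
      rw [stepFn, if_pos ⟨a, b, c, d⟩, colExt_of z hz hi hj]
      apply hf1 ⟨_, hi⟩ ⟨_, hj⟩
      · simpa using Nat.floor_le a
      · simpa using Nat.lt_floor_add_one _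
      · simpa using Nat.floor_le c
      · simpa using Nat.lt_floor_add_one _
    · rw [(stepFn_good z hz).supp x hx, Complex.ofReal_zero]
      apply hf0
      rintro ⟨a, b, c, d⟩
      simp at a b c d
      exact hx ⟨a, lt_of_le_of_ne b h1, c, lt_of_le_of_ne d h2⟩
  have hP : ∀ θ, sin θ ≠ 0 → cos θ ≠ 0 → ∀ t,
      |proj (stepFn z) θ t| ≤ 1 / 100000 * Real.sqrt N := by
    intro θ hs hc t
    have hv : ‖(!₂[-sin θ, cos θ] : EuclideanSpace ℝ (Fin 2))‖ = 1 := by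
      rw [EuclideanSpace.norm_eq]
      simp
    have h := hcon !₂[t * cos θ, t * sin θ] !₂[-sin θ, cos θ] hv
    have heq : lineIntegral f !₂[t * cos θ, t * sin θ] !₂[-sin θ, cos θ]
        = ((proj (stepFn z) θ t : ℝ) : ℂ) := by
      unfold lineIntegral proj
      rw [← integral_complex_ofReal]
      apply integral_congr_ae
      have hae : ∀ᵐ r : ℝ, r ∉ ({(t * cos θ - N) / sin θ, (N - t * sin θ) / cos θ} : Set ℝ) :=
        (Set.toFinite _).countable.ae_notMem volume
      filter_upwards [hae] with r hr
      simp only [Set.mem_insert_iff, Set.mem_singleton_iff, not_or] at hr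
      have hpt : (!₂[t * cos θ, t * sin θ] + r • !₂[-sin θ, cos θ] : EuclideanSpace ℝ (Fin 2))
          = !₂[(rpt θ t r).re, (rpt θ t r).im] := by
        ext k
        fin_cases k
        · simp [rpt]
          ring
        · simp [rpt]
      rw [hpt]
      apply hfg
      · intro h1
        apply hr.1
        rw [eq_div_iff hs]
        simp only [rpt] at h1
        linarith
      · intro h1
        apply hr.2
        rw [eq_div_iff hc]
        simp only [rpt] at h1
        linarith
    rw [heq, Complex.norm_real, Real.norm_eq_abs] at h
    exact h.le
  have hmain := main_bound hN (stepFn_good z hz) (by positivity) hP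
  rw [mul_pow, Real.sq_sqrt (by positivity)] at hmain
  have hNr : (0 : ℝ) < N := by exact_mod_cast hN
  linarith
end
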